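/- arXiv:math/9805006 — 3 statements merged into one kernel-verified Lean document; each statement's English description precedes it below -/
import Mathlib

section
/- Let A_1 = ℂ⟨x,∂⟩ be the first Weyl algebra, M = A_1/A_1·(x∂) and N = A_1/A_1·x, viewed as modules over the polynomial ring ℂ[x] via the inclusion ℂ[x] ⊆ A_1. Then Tor_0^{ℂ[x]}(M,N) ≅ A_1/A_1·x and Tor_1^{ℂ[x]}(M,N) ≅ A_1/A_1·x as ℂ[x]-modules (in fact both carry natural A_1-module structures isomorphic to A_1/A_1x). -/
open CategoryTheory

noncomputable section

set_option maxHeartbeats 1000000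
set_option synthInstance.maxHeartbeats 1000000

def Wc : Type := Module.End ℂ (Polynomial ℂ)

instance : Ring Wc := inferInstanceAs (Ring (Module.End ℂ (Polynomial ℂ)))
instance : Algebra ℂ Wc := inferInstanceAs (Algebra ℂ (Module.End ℂ (Polynomial ℂ)))

/-- `x`, acting on `ℂ[x]` by multiplication. -/
def tOp : Wc := LinearMap.mulLeft ℂ Polynomial.X
/-- `∂ = d/dx`, acting on `ℂ[x]`. -/
def dOp : Wc := Polynomial.derivative

/-- The first Weyl algebra `A_1 = ℂ⟨x,∂⟩`, realized as operators on `ℂ[x]`. -/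
def A1s : Subalgebra ℂ Wc := Algebra.adjoin ℂ {tOp, dOp}

def A1 : Type := ↥A1s
instance : Ring A1 := inferInstanceAs (Ring ↥A1s)
instance : Algebra ℂ A1 := inferInstanceAs (Algebra ℂ ↥A1s)

def tA : A1 := (⟨tOp, Algebra.subset_adjoin (Set.mem_insert _ _)⟩ : ↥A1s)
def dA : A1 := (⟨dOp, Algebra.subset_adjoin (Set.mem_insert_of_mem _ rfl)⟩ : ↥A1s)

/-- The cyclic left `A_1`-module `A_1/A_1·a`. -/
def quotMod (a : A1) : Type := A1 ⧸ (Submodule.span A1 {a})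

instance (a : A1) : AddCommGroup (quotMod a) :=
  inferInstanceAs (AddCommGroup (A1 ⧸ (Submodule.span A1 {a})))
instance (a : A1) : Module A1 (quotMod a) :=
  inferInstanceAs (Module A1 (A1 ⧸ (Submodule.span A1 {a})))

/-- The inclusion `ℂ[x] ⊆ A_1`, `x ↦ x`. -/
def incl : Polynomial ℂ →+* A1 := (Polynomial.aeval tA).toRingHom

/-- `A_1/A_1·a`, viewed as a `ℂ[x]`-module via `ℂ[x] ⊆ A_1`. -/
instance (a : A1) : Module (Polynomial ℂ) (quotMod a) := Module.compHom _ incl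

/-- `Tor_i^{ℂ[x]}(A_1/A_1·a, A_1/A_1·b)`. -/
def TorObj (i : ℕ) (a b : A1) : ModuleCat (Polynomial ℂ) :=
  (((Tor (ModuleCat (Polynomial ℂ)) i).obj (ModuleCat.of _ (quotMod a))).obj
    (ModuleCat.of _ (quotMod b)))

section Homol
open Limits HomologicalComplex
variable {C : Type*} [Category C] [Abelian C]

abbrev dblC {X₁ X₀ : C} (f : X₁ ⟶ X₀) : ChainComplex C ℕ :=
  double f (c := ComplexShape.down ℕ) (i₀ := 1) (i₁ := 0) (by simp)

lemma dblC_d {X₁ X₀ : C} (f : X₁ ⟶ X₀) : (dblC f).d 1 0 =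
    (doubleXIso₀ f _).hom ≫ f ≫ (doubleXIso₁ f _ (by simp)).inv :=
  double_d f _ (by simp)

lemma dblC_comm {X₁ X₀ : C} (f : X₁ ⟶ X₀) : (doubleXIso₀ f (by simp)).hom ≫ f =
    (dblC f).d 1 0 ≫ (doubleXIso₁ f (by simp) (by simp)).hom := by
  rw [dblC_d]; simp

def dblRes (S : ShortComplex C) (hS : S.ShortExact) (h1 : Projective S.X₁)
    (h2 : Projective S.X₂) : ProjectiveResolution S.X₃ where
  complex := dblC S.f
  projective n := by
    obtain (_ | _ | n) := n
    · exact Projective.of_iso (doubleXIso₁ S.f _ (by simp)).symm h2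
    · exact Projective.of_iso (doubleXIso₀ S.f _).symm h1
    · have := (isZero_double_X S.f (c := ComplexShape.down ℕ) (i₀ := 1) (i₁ := 0)
        (by simp) (n + 2) (by simp) (by simp))
      exact Projective.of_iso this.isoZero.symm inferInstance
  π := (ChainComplex.toSingle₀Equiv _ _).symm ⟨(doubleXIso₁ S.f _ (by simp)).hom ≫ S.g, by
      rw [dblC_d]; simp⟩
  quasiIso := ⟨fun n => by
    obtain (_ | _ | n) := n
    · rw [ChainComplex.quasiIsoAt₀_iff, ShortComplex.quasiIso_iff_of_zeros']
      · refine (ShortComplex.exact_and_epi_g_iff_of_iso ?_).2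
          ⟨hS.exact, hS.epi_g⟩
        exact ShortComplex.isoMk (doubleXIso₀ S.f _) (doubleXIso₁ S.f _ (by simp)) (Iso.refl _)
          (dblC_comm S.f) (by
            refine Eq.trans ?_ (Category.comp_id _).symm
            exact (ChainComplex.toSingle₀Equiv_symm_apply_f_zero (C := dblC S.f) _ _).symm)
      · exact double_d_eq_zero₀ S.f (c := ComplexShape.down ℕ) (by simp) 0 0 (by simp)
      all_goals rfl
    · rw [quasiIsoAt_iff_exactAt']
      · rw [HomologicalComplex.exactAt_iff' _ 2 1 0 (by simp) (by simp)]
        have := hS.mono_f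
        rw [ShortComplex.exact_iff_mono]
        · change Mono ((dblC S.f).d 1 0)
          rw [dblC_d]
          infer_instance
        · exact double_d_eq_zero₀ S.f (c := ComplexShape.down ℕ) (by simp) 2 1 (by simp)
      · apply ChainComplex.exactAt_succ_single_obj
    · rw [quasiIsoAt_iff_exactAt']
      · exact ExactAt.of_isZero (isZero_double_X S.f _ _ (by simp) (by simp))
      · apply ChainComplex.exactAt_succ_single_obj⟩

def leftDerivedOneIso {D : Type*} [Category D] [Abelian D] [HasProjectiveResolutions C] (S : ShortComplex C)
    (hS : S.ShortExact) (h1 : Projective S.X₁)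
    (h2 : Projective S.X₂) (F : C ⥤ D) [F.Additive] :
    (F.leftDerived 1).obj S.X₃ ≅ kernel (F.map S.f) :=
  (dblRes S hS h1 h2).isoLeftDerivedObj F 1 ≪≫
  (isoHomologyπ ((F.mapHomologicalComplex _).obj (dblC S.f)) 2 1 (by simp) (by
    change F.map ((dblC S.f).d 2 1) = 0
    rw [double_d_eq_zero₀ _ _ _ _ (by simp), F.map_zero])).symm ≪≫
  (IsLimit.conePointUniqueUpToIso
    (cyclesIsKernel ((F.mapHomologicalComplex _).obj (dblC S.f)) 1 0 (by simp))
    (limit.isLimit _)) ≪≫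
  kernel.mapIso _ _ (F.mapIso (doubleXIso₀ S.f _)) (F.mapIso (doubleXIso₁ S.f _ (by simp))) (by
    change F.map ((dblC S.f).d 1 0) ≫ F.map _ = F.map _ ≫ F.map _
    rw [← F.map_comp, ← F.map_comp]
    exact congrArg F.map (dblC_comm S.f).symm)
end Homol

section Alg
open Polynomial TensorProduct

variable (V : Type) [AddCommGroup V] [Module ℂ[X] V]

/-- `v e_k ↦ x v e_k + k v e_{k-1}` -/
def TV : (ℕ →₀ V) →ₗ[ℂ[X]] (ℕ →₀ V) :=
  Finsupp.lsum ℂ[X] (fun k : ℕ =>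
    (X : ℂ[X]) • Finsupp.lsingle k + (k : ℂ[X]) • Finsupp.lsingle (k - 1))

variable {V}
lemma TV_single (k : ℕ) (v : V) : TV V (Finsupp.single k v) =
    Finsupp.single k ((X : ℂ[X]) • v) + Finsupp.single (k - 1) ((k : ℂ[X]) • v) := by
  simp [TV]

lemma TV_apply (f : ℕ →₀ V) (j : ℕ) :
    TV V f j = (X : ℂ[X]) • f j + ((j + 1 : ℕ) : ℂ[X]) • f (j + 1) := by
  induction f using Finsupp.induction_linear with
  | zero => simp
  | add f g hf hg =>
    rw [map_add, Finsupp.add_apply, hf, hg, Finsupp.add_apply, Finsupp.add_apply, smul_add,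
      smul_add]; abel
  | single k v =>
    rw [TV_single, Finsupp.add_apply]
    rcases k with _ | k
    · rcases j with _ | j <;> simp
    · by_cases h1 : k = j
      · subst h1; simp
      · have h2 : ¬ (k + 1 = j + 1) := by omega
        by_cases h3 : k + 1 = j
        · subst h3; simp
        · simp [h1, h3]

lemma cinv (k : ℕ) : (C (((k + 1 : ℕ) : ℂ)⁻¹) : ℂ[X]) * ((k + 1 : ℕ) : ℂ[X]) = 1 := by
  have : ((k + 1 : ℕ) : ℂ[X]) = C ((k + 1 : ℕ) : ℂ) := by simp
  rw [this, ← C_mul, inv_mul_cancel₀ (by exact_mod_cast Nat.succ_ne_zero k), C_1]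

lemma smul_cancel (k : ℕ) {v w : V} (h : ((k + 1 : ℕ) : ℂ[X]) • v = w) :
    v = (C (((k + 1 : ℕ) : ℂ)⁻¹) : ℂ[X]) • w := by
  rw [← h, smul_smul, cinv, one_smul]

lemma TV_ker_succ {f : ℕ →₀ V} (hf : TV V f = 0) (j : ℕ) :
    f (j + 1) = (C (((j + 1 : ℕ) : ℂ)⁻¹) : ℂ[X]) • (-((X : ℂ[X]) • f j)) := by
  apply smul_cancel
  have := DFunLike.congr_fun hf j
  rw [TV_apply] at this
  exact (neg_eq_of_add_eq_zero_right this).symm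

lemma TV_ker_zero {f : ℕ →₀ V} (hf : TV V f = 0) (h0 : f 0 = 0) : f = 0 := by
  ext j
  induction j with
  | zero => exact h0
  | succ j ih => rw [TV_ker_succ hf, ih]; simp

lemma TV_ker_tors {f : ℕ →₀ V} (hf : TV V f = 0) : ∃ n : ℕ, (X : ℂ[X]) ^ n • f 0 = 0 := by
  have key : ∀ j : ℕ, ∃ c : ℂ[X], (X : ℂ[X]) ^ j • f 0 = c • f j := by
    intro j
    induction j with
    | zero => exact ⟨1, by simp⟩
    | succ j ih =>
      obtain ⟨c, hc⟩ := ih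
      refine ⟨- c * ((j + 1 : ℕ) : ℂ[X]), ?_⟩
      have := DFunLike.congr_fun hf j
      rw [TV_apply] at this
      have h2 : ((j + 1 : ℕ) : ℂ[X]) • f (j + 1) = -((X : ℂ[X]) • f j) :=
        (neg_eq_of_add_eq_zero_right this).symm
      rw [mul_smul, h2, pow_succ', mul_smul, hc, smul_comm]
      simp
  obtain ⟨n, hn⟩ := f.support.exists_nat_subset_range
  obtain ⟨c, hc⟩ := key n
  refine ⟨n, ?_⟩
  have : f n = 0 := by
    by_contra h
    exact absurd (hn (Finsupp.mem_support_iff.2 h)) (by simp)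
  rw [hc, this, smul_zero]

/-- Sequence with `s 0 = v`, `s (j+1) = - x s j / (j+1)`. -/
def seqV (v : V) : ℕ → V
  | 0 => v
  | j + 1 => (C (((j + 1 : ℕ) : ℂ)⁻¹) : ℂ[X]) • (-((X : ℂ[X]) • seqV v j))

lemma seqV_pow (v : V) (j : ℕ) : ∃ c : ℂ[X], seqV v j = c • (X : ℂ[X]) ^ j • v := by
  induction j with
  | zero => exact ⟨1, by simp [seqV]⟩
  | succ j ih =>
    obtain ⟨c, hc⟩ := ih
    refine ⟨- C (((j + 1 : ℕ) : ℂ)⁻¹) * c, ?_⟩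
    rw [seqV, hc, pow_succ']
    simp only [smul_smul, ← neg_smul]
    congr 1; ring

lemma TV_ker_exists {v : V} {n : ℕ} (hv : (X : ℂ[X]) ^ n • v = 0) :
    ∃ f : ℕ →₀ V, TV V f = 0 ∧ f 0 = v := by
  refine ⟨Finsupp.onFinset (Finset.range n) (seqV v) ?_, ?_, ?_⟩
  · intro j hj
    rw [Finset.mem_range]
    by_contra h
    obtain ⟨c, hc⟩ := seqV_pow v j
    obtain ⟨m, rfl⟩ := Nat.exists_eq_add_of_le (not_lt.1 h)
    apply hj
    rw [hc, add_comm, pow_add, mul_smul, hv]; simp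
  · ext j
    rw [TV_apply]
    simp only [Finsupp.onFinset_apply, seqV, smul_smul]
    rw [mul_comm, cinv]; simp
  · rfl

lemma TR_inj : Function.Injective (TV ℂ[X]) := by
  rw [injective_iff_map_eq_zero]
  intro f hf
  obtain ⟨n, hn⟩ := TV_ker_tors hf
  apply TV_ker_zero hf
  simpa using hn

/-- Model of `A_1 / A_1 x`. -/
abbrev NF : Type := (ℕ →₀ ℂ[X]) ⧸ LinearMap.range (TV ℂ[X])

abbrev nk (k : ℕ) : NF := Submodule.Quotient.mk (Finsupp.single k 1)

lemma nk_rel (k : ℕ) : (X : ℂ[X]) • nk k = - ((k : ℂ[X]) • nk (k - 1)) := by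
  rw [eq_neg_iff_add_eq_zero]
  have : TV ℂ[X] (Finsupp.single k 1) ∈ LinearMap.range (TV ℂ[X]) := ⟨_, rfl⟩
  rw [← Submodule.Quotient.mk_eq_zero, TV_single, Submodule.Quotient.mk_add] at this
  rw [← this, ← Submodule.Quotient.mk_smul, ← Submodule.Quotient.mk_smul, Finsupp.smul_single,
    Finsupp.smul_single]

lemma NF_induction {P : NF → Prop} (h0 : P 0) (hadd : ∀ a b, P a → P b → P (a + b))
    (hk : ∀ (p : ℂ[X]) k, P (p • nk k)) (a : NF) : P a := by
  obtain ⟨f, rfl⟩ := Submodule.Quotient.mk_surjective _ a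
  induction f using Finsupp.induction_linear with
  | zero => exact h0
  | add f g hf hg => exact hadd _ _ hf hg
  | single k p =>
    have := hk p k
    rwa [← Submodule.Quotient.mk_smul, Finsupp.smul_single, smul_eq_mul, mul_one] at this

lemma NF_tors (a : NF) : ∃ n : ℕ, (X : ℂ[X]) ^ n • a = 0 := by
  induction a using NF_induction with
  | h0 => exact ⟨0, by simp⟩
  | hadd a b ha hb =>
    obtain ⟨n, hn⟩ := ha
    obtain ⟨m, hm⟩ := hb
    refine ⟨n + m, ?_⟩
    rw [smul_add, pow_add, mul_smul _ _ b, hm, mul_comm, mul_smul, hn]; simp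
  | hk p k =>
    refine ⟨k + 1, ?_⟩
    rw [smul_comm]
    suffices h : (X : ℂ[X]) ^ (k + 1) • nk k = 0 by rw [h, smul_zero]
    induction k with
    | zero => rw [zero_add, pow_one, nk_rel]; simp
    | succ k ih =>
      rw [pow_succ, mul_smul, nk_rel, Nat.add_sub_cancel, smul_neg, smul_comm, ih]; simp

lemma NF_div1 (a : NF) : ∃ b, a = (X : ℂ[X]) • b := by
  induction a using NF_induction with
  | h0 => exact ⟨0, by simp⟩
  | hadd a b ha hb =>
    obtain ⟨n, hn⟩ := ha
    obtain ⟨m, hm⟩ := hb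
    exact ⟨n + m, by rw [smul_add, ← hn, ← hm]⟩
  | hk p k =>
    refine ⟨p • (C (((k + 1 : ℕ) : ℂ)⁻¹) : ℂ[X]) • - nk (k + 1), ?_⟩
    rw [smul_comm _ p]
    congr 1
    rw [smul_comm]
    apply smul_cancel
    rw [smul_neg, nk_rel, neg_neg, Nat.add_sub_cancel]

lemma NF_div (a : NF) (n : ℕ) : ∃ b, a = (X : ℂ[X]) ^ n • b := by
  induction n with
  | zero => exact ⟨a, by simp⟩
  | succ n ih =>
    obtain ⟨b, hb⟩ := ih
    obtain ⟨c, hc⟩ := NF_div1 b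
    exact ⟨c, by rw [pow_succ, mul_smul, ← hc, hb]⟩

lemma NF_tensor (z : NF ⊗[ℂ[X]] NF) : z = 0 := by
  induction z using TensorProduct.induction_on with
  | zero => rfl
  | add a b ha hb => rw [ha, hb, add_zero]
  | tmul a b =>
    obtain ⟨n, hn⟩ := NF_tors a
    obtain ⟨c, rfl⟩ := NF_div b n
    rw [← TensorProduct.smul_tmul, hn, TensorProduct.zero_tmul]

abbrev MF : Type := ℂ[X] × NF

instance : Subsingleton (NF ⊗[ℂ[X]] NF) := ⟨fun a b => by rw [NF_tensor a, NF_tensor b]⟩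

instance : Unique (NF ⊗[ℂ[X]] NF) := Unique.mk' _

def tor0 : (MF ⊗[ℂ[X]] NF) ≃ₗ[ℂ[X]] NF :=
  TensorProduct.prodLeft ℂ[X] ℂ[X] ℂ[X] NF NF ≪≫ₗ
    LinearEquiv.prodUnique ≪≫ₗ TensorProduct.lid _ _

def kerMap : LinearMap.ker (TV MF) →ₗ[ℂ[X]] NF :=
  LinearMap.snd _ _ _ ∘ₗ Finsupp.lapply 0 ∘ₗ (LinearMap.ker (TV MF)).subtype

def kerEquiv : LinearMap.ker (TV MF) ≃ₗ[ℂ[X]] NF :=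
  LinearEquiv.ofBijective kerMap (by
    constructor
    · rw [injective_iff_map_eq_zero]
      rintro ⟨f, hf⟩ h
      change (f 0).2 = 0 at h
      rw [Submodule.mk_eq_zero]
      have hf : TV MF f = 0 := hf
      obtain ⟨n, hn⟩ := TV_ker_tors hf
      refine TV_ker_zero hf (Prod.ext ?_ h)
      have := congrArg Prod.fst hn
      simpa using this
    · intro a
      obtain ⟨n, hn⟩ := NF_tors a
      have : (X : ℂ[X]) ^ n • ((0, a) : MF) = 0 := by
        rw [Prod.smul_mk, hn, smul_zero]; rfl
      obtain ⟨f, hf, hf0⟩ := TV_ker_exists this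
      refine ⟨⟨f, hf⟩, ?_⟩
      change (f 0).2 = a
      rw [hf0])

lemma finsupp_comm (z : V ⊗[ℂ[X]] (ℕ →₀ ℂ[X])) :
    TensorProduct.finsuppScalarRight ℂ[X] ℂ[X] V ℕ (LinearMap.lTensor V (TV ℂ[X]) z) =
    TV V (TensorProduct.finsuppScalarRight ℂ[X] ℂ[X] V ℕ z) := by
  induction z using TensorProduct.induction_on with
  | zero => simp
  | add a b ha hb => simp only [map_add, ha, hb]
  | tmul v f =>
    induction f using Finsupp.induction_linear with
    | zero => simp
    | add a b ha hb => simp only [TensorProduct.tmul_add, map_add, ha, hb]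
    | single k p =>
      rw [LinearMap.lTensor_tmul, TV_single, TensorProduct.tmul_add, map_add]
      simp only [TensorProduct.finsuppScalarRight_apply_tmul, Finsupp.sum_single_index, zero_smul, Finsupp.single_zero]
      rw [TV_single]
      simp only [smul_smul, smul_eq_mul]

end Alg

section Weyl
open Polynomial

def Lmap : (ℕ →₀ ℂ[X]) →+ A1 :=
  Finsupp.liftAddHom (fun k : ℕ => (AddMonoidHom.mulRight (dA ^ k)).comp incl.toAddMonoidHom)

lemma Lmap_single (k : ℕ) (p : ℂ[X]) : Lmap (Finsupp.single k p) = incl p * dA ^ k := by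
  simp [Lmap]

lemma Lmap_smul (p : ℂ[X]) (f : ℕ →₀ ℂ[X]) : Lmap (p • f) = incl p * Lmap f := by
  induction f using Finsupp.induction_linear with
  | zero => simp
  | add a b ha hb => rw [smul_add, map_add, map_add, ha, hb, mul_add]
  | single k q =>
    rw [Finsupp.smul_single, Lmap_single, Lmap_single, smul_eq_mul, map_mul, mul_assoc]

lemma weyl_rel_end : ((Polynomial.derivative : ℂ[X] →ₗ[ℂ] ℂ[X]) * LinearMap.mulLeft ℂ X :
    Module.End ℂ ℂ[X]) =
    (LinearMap.mulLeft ℂ X : Module.End ℂ ℂ[X]) * (Polynomial.derivative : ℂ[X] →ₗ[ℂ] ℂ[X]) + 1 := by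
  refine LinearMap.ext fun q => ?_
  rw [LinearMap.add_apply, Module.End.mul_apply, Module.End.mul_apply, Module.End.one_apply,
    LinearMap.mulLeft_apply, LinearMap.mulLeft_apply, derivative_mul, derivative_X, one_mul,
    add_comm]

lemma weyl_rel : dA * tA = tA * dA + 1 := by
  apply Subtype.ext
  exact weyl_rel_end

lemma weyl_pow (k : ℕ) : dA ^ k * tA = tA * dA ^ k + (k : A1) * dA ^ (k - 1) := by
  induction k with
  | zero => simp
  | succ k ih =>
    rw [pow_succ, mul_assoc, weyl_rel, mul_add, ← mul_assoc, ih, add_mul, mul_one, Nat.add_sub_cancel]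
    rcases k with _ | k
    · simp
    · rw [Nat.add_sub_cancel, mul_assoc _ (dA ^ k), ← pow_succ, mul_assoc, ← pow_succ]
      push_cast
      noncomm_ring

lemma incl_X : incl X = tA := by
  change Polynomial.aeval tA X = tA
  simp

lemma incl_comm (p : ℂ[X]) : incl p * tA = incl (X * p) := by
  rw [mul_comm, map_mul, incl_X]

lemma Lmap_T (f : ℕ →₀ ℂ[X]) : Lmap (TV ℂ[X] f) = Lmap f * tA := by
  induction f using Finsupp.induction_linear with
  | zero => simp
  | add a b ha hb => rw [map_add, map_add, map_add, ha, hb, add_mul]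
  | single k q =>
    rw [TV_single, map_add, Lmap_single, Lmap_single, Lmap_single, mul_assoc, weyl_pow, mul_add,
      ← mul_assoc, incl_comm, ← mul_assoc, smul_eq_mul, smul_eq_mul, mul_comm (k : ℂ[X]) q,
      map_mul incl q, map_natCast]

abbrev Dmap : (ℕ →₀ ℂ[X]) →ₗ[ℂ[X]] (ℕ →₀ ℂ[X]) := Finsupp.lmapDomain ℂ[X] ℂ[X] Nat.succ

lemma Lmap_D (f : ℕ →₀ ℂ[X]) : Lmap (Dmap f) = Lmap f * dA := by
  induction f using Finsupp.induction_linear with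
  | zero => simp
  | add a b ha hb => rw [map_add, map_add, map_add, ha, hb, add_mul]
  | single k q =>
    rw [Finsupp.lmapDomain_apply, Finsupp.mapDomain_single, Lmap_single, Lmap_single, mul_assoc,
      ← pow_succ]

lemma Lmap_right (a : Wc) (ha : a ∈ A1s) :
    ∀ f : ℕ →₀ ℂ[X], ∃ g, Lmap g = Lmap f * (show A1 from (⟨a, ha⟩ : ↥A1s)) := by
  induction ha using Algebra.adjoin_induction with
  | mem x hx =>
    intro f
    rcases hx with rfl | rfl
    · exact ⟨_, Lmap_T f⟩
    · exact ⟨_, Lmap_D f⟩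
  | algebraMap r =>
    intro f
    refine ⟨C r • f, ?_⟩
    rw [Lmap_smul]
    have : incl (C r) = algebraMap ℂ A1 r := by
      change Polynomial.aeval tA (C r) = _
      simp
    rw [this]
    exact Algebra.commutes r (Lmap f)
  | add x y hx hy ihx ihy =>
    intro f
    obtain ⟨g, hg⟩ := ihx f
    obtain ⟨h, hh⟩ := ihy f
    refine ⟨g + h, ?_⟩
    rw [map_add, hg, hh]
    exact (mul_add (Lmap f) _ _).symm
  | mul x y hx hy ihx ihy =>
    intro f
    obtain ⟨g, hg⟩ := ihx f
    obtain ⟨h, hh⟩ := ihy g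
    refine ⟨h, ?_⟩
    rw [hh, hg]
    exact mul_assoc (Lmap f) _ _

lemma Lmap_surj : Function.Surjective Lmap := by
  rintro ⟨a, ha⟩
  obtain ⟨g, hg⟩ := Lmap_right a ha (Finsupp.single 0 1)
  refine ⟨g, ?_⟩
  rw [hg, Lmap_single, map_one, pow_zero, one_mul, one_mul]

def act : A1 →ₐ[ℂ] Module.End ℂ ℂ[X] := A1s.val

lemma act_incl (p : ℂ[X]) : act (incl p) = Algebra.lmul ℂ ℂ[X] p := by
  change act (Polynomial.aeval tA p) = _
  rw [← Polynomial.aeval_algHom_apply]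
  have : act tA = Algebra.lmul ℂ ℂ[X] X := rfl
  rw [this, Polynomial.aeval_algHom_apply, Polynomial.aeval_X_left_apply]

lemma act_d (k : ℕ) (q : ℂ[X]) : act (dA ^ k) q = Polynomial.derivative^[k] q := by
  have : act dA = (Polynomial.derivative : ℂ[X] →ₗ[ℂ] ℂ[X]) := rfl
  rw [map_pow, this, Module.End.pow_apply]

lemma act_L (f : ℕ →₀ ℂ[X]) (q : ℂ[X]) :
    act (Lmap f) q = f.sum (fun k p => p * Polynomial.derivative^[k] q) := by
  induction f using Finsupp.induction_linear with
  | zero => simp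
  | add a b ha hb =>
    rw [map_add, map_add, LinearMap.add_apply, ha, hb, Finsupp.sum_add_index'] <;> simp [add_mul]
  | single k p =>
    rw [Lmap_single, map_mul, act_incl, Finsupp.sum_single_index (by simp), Module.End.mul_apply,
      act_d]
    rfl

lemma Lmap_inj : Function.Injective Lmap := by
  rw [injective_iff_map_eq_zero]
  intro f hf
  ext1 j
  induction j using Nat.strong_induction_on with
  | _ j ih =>
    have h := act_L f (X ^ j)
    rw [hf, map_zero, LinearMap.zero_apply, Finsupp.sum, Finset.sum_eq_single j] at h
    · rw [Polynomial.iterate_derivative_X_pow_eq_natCast_mul] at h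
      simpa [Nat.descFactorial_self, Nat.factorial_ne_zero] using h.symm
    · intro k _ hk
      rcases lt_or_gt_of_ne hk with h1 | h1
      · rw [ih k h1]; simp
      · rw [Polynomial.iterate_derivative_eq_zero (by simpa using h1), mul_zero]
    · intro hj
      rw [Finsupp.notMem_support_iff.1 hj, zero_mul]

def qmap (a : A1) : (ℕ →₀ ℂ[X]) →ₗ[ℂ[X]] quotMod a where
  toFun f := (Submodule.Quotient.mk (Lmap f) : A1 ⧸ (Submodule.span A1 {a}))
  map_add' f g := by rw [map_add]; rfl
  map_smul' p f := by rw [Lmap_smul]; rfl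

lemma qmap_surj (a : A1) : Function.Surjective (qmap a) := by
  intro b
  obtain ⟨c, rfl⟩ := Submodule.Quotient.mk_surjective (Submodule.span A1 {a}) b
  obtain ⟨f, rfl⟩ := Lmap_surj c
  exact ⟨f, rfl⟩

lemma qmap_ker (a : A1) (U : (ℕ →₀ ℂ[X]) →ₗ[ℂ[X]] (ℕ →₀ ℂ[X]))
    (hU : ∀ f, Lmap (U f) = Lmap f * a) : LinearMap.ker (qmap a) = LinearMap.range U := by
  ext f
  rw [LinearMap.mem_ker, LinearMap.mem_range]
  change (Submodule.Quotient.mk (Lmap f) : A1 ⧸ (Submodule.span A1 {a})) = 0 ↔ _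
  rw [Submodule.Quotient.mk_eq_zero, Submodule.mem_span_singleton]
  constructor
  · rintro ⟨b, hb⟩
    obtain ⟨g, rfl⟩ := Lmap_surj b
    exact ⟨g, Lmap_inj (by rw [hU, ← hb, smul_eq_mul])⟩
  · rintro ⟨g, rfl⟩
    exact ⟨Lmap g, by rw [hU, smul_eq_mul]⟩

def equivN : quotMod tA ≃ₗ[ℂ[X]] NF :=
  ((qmap tA).quotKerEquivOfSurjective (qmap_surj tA)).symm ≪≫ₗ
    Submodule.quotEquivOfEq _ _ (qmap_ker tA (TV ℂ[X]) Lmap_T)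

def toMF : (ℕ →₀ ℂ[X]) →ₗ[ℂ[X]] MF :=
  (Finsupp.lapply 0).prod
    ((LinearMap.range (TV ℂ[X])).mkQ ∘ₗ Finsupp.lcomapDomain Nat.succ Nat.succ_injective)

lemma shift_D (g : ℕ →₀ ℂ[X]) :
    Finsupp.lcomapDomain (R := ℂ[X]) Nat.succ Nat.succ_injective (Dmap g) = g := by
  ext1 j
  change (Finsupp.mapDomain Nat.succ g) (Nat.succ j) = g j
  rw [Finsupp.mapDomain_apply Nat.succ_injective]

lemma D_zero (g : ℕ →₀ ℂ[X]) : Dmap g 0 = 0 := by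
  change (Finsupp.mapDomain Nat.succ g) 0 = 0
  rw [Finsupp.mapDomain_of_notMem_range]
  simp

lemma toMF_surj : Function.Surjective toMF := by
  rintro ⟨p, b⟩
  obtain ⟨g, rfl⟩ := Submodule.Quotient.mk_surjective _ b
  refine ⟨Finsupp.single 0 p + Dmap g, ?_⟩
  have h : Finsupp.lcomapDomain (R := ℂ[X]) Nat.succ Nat.succ_injective (Finsupp.single 0 p) = 0 := by
    ext1 j
    change (Finsupp.single 0 p) (Nat.succ j) = 0
    simp
  refine Prod.ext ?_ ?_
  · change (Finsupp.single 0 p + Dmap g : ℕ →₀ ℂ[X]) 0 = p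
    rw [Finsupp.add_apply, D_zero]; simp
  · change Submodule.Quotient.mk (Finsupp.lcomapDomain (R := ℂ[X]) Nat.succ Nat.succ_injective
      (Finsupp.single 0 p + Dmap g)) = _
    rw [map_add, h, shift_D, zero_add]

lemma toMF_ker : LinearMap.ker toMF = LinearMap.range (Dmap ∘ₗ TV ℂ[X]) := by
  ext f
  rw [LinearMap.mem_ker, LinearMap.mem_range]
  constructor
  · intro h
    have h1 : f 0 = 0 := congrArg Prod.fst h
    have h2 : Submodule.Quotient.mk (p := LinearMap.range (TV ℂ[X]))
      (Finsupp.lcomapDomain (R := ℂ[X]) Nat.succ Nat.succ_injective f) = 0 := congrArg Prod.snd h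
    rw [Submodule.Quotient.mk_eq_zero] at h2
    obtain ⟨g, hg⟩ := h2
    refine ⟨g, ?_⟩
    ext1 j
    rw [LinearMap.comp_apply]
    rcases j with _ | j
    · rw [D_zero, h1]
    · change (Finsupp.mapDomain Nat.succ (TV ℂ[X] g)) (Nat.succ j) = _
      rw [Finsupp.mapDomain_apply Nat.succ_injective, hg]
      rfl
  · rintro ⟨g, rfl⟩
    refine Prod.ext (D_zero _) ?_
    change Submodule.Quotient.mk (p := LinearMap.range (TV ℂ[X]))
      (Finsupp.lcomapDomain (R := ℂ[X]) Nat.succ Nat.succ_injective (Dmap (TV ℂ[X] g))) = 0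
    rw [shift_D, Submodule.Quotient.mk_eq_zero]
    exact ⟨g, rfl⟩

def equivM : quotMod (tA * dA) ≃ₗ[ℂ[X]] MF :=
  ((qmap (tA * dA)).quotKerEquivOfSurjective (qmap_surj _)).symm ≪≫ₗ
    Submodule.quotEquivOfEq _ _ ((qmap_ker (tA * dA) (Dmap ∘ₗ TV ℂ[X]) (fun f => by
      rw [LinearMap.comp_apply, Lmap_D, Lmap_T, mul_assoc])).trans toMF_ker.symm) ≪≫ₗ
    toMF.quotKerEquivOfSurjective toMF_surj

end Weyl

section Final
open Polynomial TensorProduct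

def torTransport (i : ℕ) : TorObj i (tA * dA) tA ≅
    ((Tor (ModuleCat ℂ[X]) i).obj (ModuleCat.of ℂ[X] MF)).obj (ModuleCat.of ℂ[X] NF) :=
  ((Tor (ModuleCat ℂ[X]) i).mapIso equivM.toModuleIso).app _ ≪≫
    ((Tor (ModuleCat ℂ[X]) i).obj (ModuleCat.of ℂ[X] MF)).mapIso equivN.toModuleIso

def tor0Iso (M N : ModuleCat.{0} ℂ[X]) : ((Tor (ModuleCat ℂ[X]) 0).obj M).obj N ≅
    ModuleCat.of _ (M ⊗[ℂ[X]] N) :=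
  haveI : Limits.PreservesFiniteColimits
      ((MonoidalCategory.tensoringLeft (ModuleCat.{0} ℂ[X])).obj M) :=
    inferInstanceAs (Limits.PreservesFiniteColimits (MonoidalCategory.tensorLeft M))
  (Functor.leftDerivedZeroIsoSelf
    ((MonoidalCategory.tensoringLeft (ModuleCat.{0} ℂ[X])).obj M)).app N

def resS : ShortComplex (ModuleCat.{0} ℂ[X]) :=
  ShortComplex.mk (X₁ := ModuleCat.of ℂ[X] (ℕ →₀ ℂ[X])) (X₂ := ModuleCat.of ℂ[X] (ℕ →₀ ℂ[X]))
    (X₃ := ModuleCat.of ℂ[X] NF)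
    (ModuleCat.ofHom (TV ℂ[X])) (ModuleCat.ofHom (LinearMap.range (TV ℂ[X])).mkQ) (by
      ext1
      exact LinearMap.range_mkQ_comp _)

lemma resS_exact : resS.ShortExact := by
  refine ModuleCat.shortComplex_shortExact _ ?_ TR_inj (Submodule.mkQ_surjective _)
  rw [LinearMap.exact_iff]
  exact Submodule.ker_mkQ _

lemma projF : Projective (ModuleCat.of ℂ[X] (ℕ →₀ ℂ[X])) :=
  (IsProjective.iff_projective (R := ℂ[X]) (ℕ →₀ ℂ[X])).1 inferInstance

def tensorKer : LinearMap.ker (LinearMap.lTensor MF (TV ℂ[X])) ≃ₗ[ℂ[X]] LinearMap.ker (TV MF) :=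
  LinearEquiv.ofSubmodules (TensorProduct.finsuppScalarRight ℂ[X] ℂ[X] MF ℕ) _ _ (by
    ext f
    rw [Submodule.mem_map_equiv, LinearMap.mem_ker, LinearMap.mem_ker]
    obtain ⟨z, rfl⟩ := (TensorProduct.finsuppScalarRight ℂ[X] ℂ[X] MF ℕ).surjective f
    rw [LinearEquiv.symm_apply_apply, ← finsupp_comm, LinearEquiv.map_eq_zero_iff])

def tor1Iso : ((Tor (ModuleCat ℂ[X]) 1).obj (ModuleCat.of ℂ[X] MF)).obj (ModuleCat.of ℂ[X] NF) ≅
    ModuleCat.of ℂ[X] NF :=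
  leftDerivedOneIso resS resS_exact projF projF
    ((MonoidalCategory.tensoringLeft (ModuleCat.{0} ℂ[X])).obj (ModuleCat.of ℂ[X] MF)) ≪≫
  ModuleCat.kernelIsoKer _ ≪≫
  (tensorKer ≪≫ₗ kerEquiv).toModuleIso

end Final

end


/-- for `M = A_1/A_1·(x∂)` and `N = A_1/A_1·x`, both
`Tor_0^{ℂ[x]}(M,N)` and `Tor_1^{ℂ[x]}(M,N)` are isomorphic to `A_1/A_1·x`
as `ℂ[x]`-modules. -/
theorem stmt_14 :
    Nonempty (TorObj 0 (tA * dA) tA ≅ ModuleCat.of (Polynomial ℂ) (quotMod tA)) ∧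
    Nonempty (TorObj 1 (tA * dA) tA ≅ ModuleCat.of (Polynomial ℂ) (quotMod tA)) := by
  exact ⟨⟨torTransport 0 ≪≫ tor0Iso _ _ ≪≫ (tor0 ≪≫ₗ equivN.symm).toModuleIso⟩,
    ⟨torTransport 1 ≪≫ tor1Iso ≪≫ equivN.symm.toModuleIso⟩⟩
end

section
/- Let A_1 = ℂ⟨x,∂⟩ and N = A_1/A_1·x, regarded as a module over ℂ[x] ⊆ A_1. Then Tor_0^{ℂ[x]}(N,N) = 0 and Tor_1^{ℂ[x]}(N,N) ≅ A_1/A_1·x. -/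
open CategoryTheory

namespace TorAux
universe v u
open Limits ZeroObject
section cat
variable {C : Type u} [Category.{v} C] [Abelian C] {P Q Z : C} (d : P ⟶ Q) (ε : Q ⟶ Z)

noncomputable def cX (P Q : C) : ℕ → C
  | 0 => Q
  | 1 => P
  | _ + 2 => 0

noncomputable def cd : ∀ n, cX P Q (n + 1) ⟶ cX P Q n
  | 0 => d
  | _ + 1 => 0

noncomputable def cplx : ChainComplex C ℕ :=
  ChainComplex.of (cX P Q) (cd d) (fun n => by cases n <;> exact zero_comp)

lemma cplx_d10 : (cplx d).d 1 0 = d := ChainComplex.of_d (cX P Q) (cd d) 0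

lemma cplx_isZero (n : ℕ) : IsZero ((cplx d).X (n + 2)) := isZero_zero C

noncomputable def res [Projective P] [Projective Q] [Mono d] [Epi ε] (w : d ≫ ε = 0)
    (hex : (ShortComplex.mk d ε w).Exact) : ProjectiveResolution Z where
  complex := cplx d
  projective := fun n => match n with
    | 0 => (inferInstance : Projective Q)
    | 1 => (inferInstance : Projective P)
    | _ + 2 => (inferInstance : Projective (0 : C))
  π := (ChainComplex.toSingle₀Equiv _ _).symm ⟨ε, by rw [cplx_d10]; exact w⟩
  quasiIso := ⟨fun n => by
    cases n with
    | zero =>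
      rw [ChainComplex.quasiIsoAt₀_iff, ShortComplex.quasiIso_iff_of_zeros']
      · refine (ShortComplex.exact_and_epi_g_iff_of_iso ?_).2
          ⟨hex, (inferInstance : Epi ε)⟩
        exact ShortComplex.isoMk (Iso.refl _) (Iso.refl _) (Iso.refl _)
          
          ((Category.id_comp d).trans ((Category.comp_id _).trans (cplx_d10 d)).symm)
          ((Category.id_comp ε).trans ((Category.comp_id _).trans
            (ChainComplex.toSingle₀Equiv_symm_apply_f_zero (C := cplx d) ε
              (by rw [cplx_d10]; exact w))).symm)
      all_goals rfl
    | succ n =>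
      rw [quasiIsoAt_iff_exactAt']
      · cases n with
        | zero =>
          rw [HomologicalComplex.exactAt_iff' _ 2 1 0 (by simp) (by simp)]
          have : Mono ((cplx d).sc' 2 1 0).g := by
            have h : ((cplx d).sc' 2 1 0).g = d := cplx_d10 d
            rw [h]; assumption
          rw [ShortComplex.exact_iff_mono _ ((cplx_isZero d 0).eq_of_src _ _)]
          infer_instance
        | succ n => exact HomologicalComplex.ExactAt.of_isZero (cplx_isZero d n)
      · apply ChainComplex.exactAt_succ_single_obj⟩

variable {D : Type u} [Category.{v} D] [Abelian D] [HasProjectiveResolutions C]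
lemma derived_zero (F : C ⥤ D) [F.Additive] [Projective P] [Projective Q] [Mono d] [Epi ε] (w : d ≫ ε = 0)
    (hex : (ShortComplex.mk d ε w).Exact) (h : Epi (F.map d)) :
    IsZero ((F.leftDerived 0).obj Z) := by
  refine IsZero.of_iso ?_ ((res d ε w hex).isoLeftDerivedObj F 0)
  refine HomologicalComplex.ExactAt.isZero_homology ?_
  rw [HomologicalComplex.exactAt_iff' _ 1 0 0 (by simp) (by simp)]
  have h0 : (((F.mapHomologicalComplex _).obj (res d ε w hex).complex).sc' 1 0 0).f = F.map d := by
    exact congrArg F.map (cplx_d10 d)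
  rw [ShortComplex.exact_iff_epi]
  · rw [h0]; exact h
  · exact HomologicalComplex.shape ((F.mapHomologicalComplex _).obj (res d ε w hex).complex) _ _ (show ¬ (ComplexShape.down ℕ).Rel 0 0 by simp)

lemma derived_one (F : C ⥤ D) [F.Additive] [Projective P] [Projective Q] [Mono d] [Epi ε] (w : d ≫ ε = 0)
    (hex : (ShortComplex.mk d ε w).Exact) {T : D} (i : T ⟶ F.obj P) [Mono i] (wi : i ≫ F.map d = 0)
    (hi : (ShortComplex.mk i (F.map d) wi).Exact) :
    Nonempty ((F.leftDerived 1).obj Z ≅ T) := by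
  refine ⟨(res d ε w hex).isoLeftDerivedObj F 1 ≪≫ ?_⟩
  let K := (F.mapHomologicalComplex _).obj (res d ε w hex).complex
  have hd : K.d 1 0 = F.map d := congrArg F.map (cplx_d10 d)
  have hz : K.d 2 1 = 0 := (F.map_isZero (cplx_isZero d 0)).eq_of_src _ _
  refine (K.isoHomologyπ 2 1 (by simp) hz).symm ≪≫ ?_
  refine IsLimit.conePointUniqueUpToIso (K.cyclesIsKernel 1 0 (by simp)) (t := KernelFork.ofι (f := K.d 1 0) i (by rw [hd]; exact wi)) ?_
  have e := hi.fIsKernel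
  have : Mono (C := D) (Y := K.X 1) i := ‹Mono i›
  refine KernelFork.IsLimit.ofι' (X := K.X 1) _ _ (fun {A} k hk => ⟨e.lift (KernelFork.ofι k (by rw [hd] at hk; exact hk)), ?_⟩)
  exact e.fac _ WalkingParallelPair.zero
end cat
end TorAux

namespace TorAux
open Polynomial
section mods
variable {M : Type} [AddCommGroup M] [Module ℂ[X] M]

/-- `(d n)_k = x n_k - n_{k+1}` on finitely supported sequences. -/
noncomputable def dM (M : Type) [AddCommGroup M] [Module ℂ[X] M] : (ℕ →₀ M) →ₗ[ℂ[X]] (ℕ →₀ M) :=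
  (X : ℂ[X]) • LinearMap.id - Finsupp.lcomapDomain Nat.succ Nat.succ_injective

lemma dM_apply (n : ℕ →₀ M) (k : ℕ) : dM M n k = (X : ℂ[X]) • n k - n (k + 1) := by
  simp [dM, Finsupp.lcomapDomain]

lemma dM_single_zero (m : M) : dM M (Finsupp.single 0 m) = Finsupp.single 0 ((X : ℂ[X]) • m) := by
  ext k
  rw [dM_apply]
  rcases k with _ | k <;> simp

lemma dM_single_succ (j : ℕ) (m : M) : dM M (Finsupp.single (j + 1) m) =
    Finsupp.single (j + 1) ((X : ℂ[X]) • m) - Finsupp.single j m := by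
  ext k
  rw [dM_apply]
  simp [Finsupp.single_apply]

lemma dM_surj (hs : ∀ m : M, ∃ m', (X : ℂ[X]) • m' = m) : Function.Surjective (dM M) := by
  rw [← LinearMap.range_eq_top, eq_top_iff]
  rintro f -
  induction f using Finsupp.induction_linear with
  | zero => exact zero_mem _
  | add f g hf hg => exact add_mem hf hg
  | single k m =>
    induction k generalizing m with
    | zero =>
      obtain ⟨m', rfl⟩ := hs m
      exact ⟨_, dM_single_zero m'⟩
    | succ k ih =>
      obtain ⟨m', rfl⟩ := hs m
      have h := add_mem (LinearMap.mem_range_self (dM M) (Finsupp.single (k + 1) m')) (ih m')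
      rwa [dM_single_succ, sub_add_cancel] at h

lemma dM_ker {n : ℕ →₀ M} (h : dM M n = 0) (k : ℕ) : n k = (X : ℂ[X]) ^ k • n 0 := by
  induction k with
  | zero => simp
  | succ k ih =>
    have := DFunLike.congr_fun h k
    rw [dM_apply, Finsupp.zero_apply, sub_eq_zero] at this
    rw [← this, ih, smul_smul, pow_succ']

lemma dM_inj : Function.Injective (dM ℂ[X]) := by
  rw [injective_iff_map_eq_zero]
  intro f hf
  have h := dM_ker hf
  obtain ⟨k, hk⟩ := Infinite.exists_notMem_finset f.support
  have h0 : f 0 = 0 := by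
    have := h k
    rw [Finsupp.notMem_support_iff.1 hk, eq_comm, smul_eq_mul] at this
    simpa using this
  ext1 j
  rw [h, h0, smul_zero, Finsupp.zero_apply]

/-- `n ↦ (x^k n)_k`. -/
noncomputable def iM (hn : ∀ m : M, ∃ k : ℕ, (X : ℂ[X]) ^ k • m = 0) : M →ₗ[ℂ[X]] (ℕ →₀ M) where
  toFun m := Finsupp.ofSupportFinite (fun k => (X : ℂ[X]) ^ k • m) (by
    obtain ⟨K, hK⟩ := hn m
    refine (Set.finite_lt_nat K).subset fun k hk => ?_
    by_contra hlt
    refine hk ?_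
    simp only [Set.mem_ofPred_eq, not_lt] at hlt
    simp only
    rw [← Nat.sub_add_cancel hlt, pow_add, mul_smul, hK, smul_zero])
  map_add' a b := by ext k; simp [Finsupp.ofSupportFinite_coe]
  map_smul' r a := by ext k; simp [Finsupp.ofSupportFinite_coe, smul_smul, mul_comm]

lemma iM_apply (hn : ∀ m : M, ∃ k : ℕ, (X : ℂ[X]) ^ k • m = 0) (m : M) (k : ℕ) :
    iM hn m k = (X : ℂ[X]) ^ k • m := rfl

lemma iM_inj (hn : ∀ m : M, ∃ k : ℕ, (X : ℂ[X]) ^ k • m = 0) : Function.Injective (iM hn) := by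
  intro a b h
  simpa [iM_apply] using DFunLike.congr_fun h 0

lemma iM_exact (hn : ∀ m : M, ∃ k : ℕ, (X : ℂ[X]) ^ k • m = 0) :
    Function.Exact (iM hn) (dM M) := by
  intro n
  constructor
  · intro h
    exact ⟨n 0, by ext k; rw [iM_apply, dM_ker h k]⟩
  · rintro ⟨m, rfl⟩
    ext k
    rw [dM_apply, iM_apply, iM_apply, pow_succ', mul_smul, sub_self, Finsupp.zero_apply]

/-- tensoring -/
noncomputable def eT (M : Type) [AddCommGroup M] [Module ℂ[X] M] :
    TensorProduct ℂ[X] M (ℕ →₀ ℂ[X]) ≃ₗ[ℂ[X]] (ℕ →₀ M) :=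
  TensorProduct.finsuppScalarRight ℂ[X] ℂ[X] M ℕ

lemma eT_comm (z : TensorProduct ℂ[X] M (ℕ →₀ ℂ[X])) :
    eT M (LinearMap.lTensor M (dM ℂ[X]) z) = dM M (eT M z) := by
  induction z using TensorProduct.induction_on with
  | zero => simp
  | add a b ha hb => simp only [map_add, ha, hb]
  | tmul m f =>
    ext k
    rw [dM_apply]
    simp [eT, TensorProduct.finsuppScalarRight_apply_tmul_apply, dM_apply, sub_smul, mul_smul]

variable (e : ℕ → M)

lemma pow_self (hsucc : ∀ k, (X : ℂ[X]) • e (k + 1) = e k) (k : ℕ) : (X : ℂ[X]) ^ k • e k = e 0 := by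
  induction k with
  | zero => simp
  | succ k ih => rw [pow_succ, mul_smul, hsucc, ih]

lemma pow_lt (h0 : (X : ℂ[X]) • e 0 = 0)
    (hsucc : ∀ k, (X : ℂ[X]) • e (k + 1) = e k) {k K : ℕ} (h : k < K) : (X : ℂ[X]) ^ K • e k = 0 := by
  obtain ⟨j, rfl⟩ := Nat.exists_eq_add_of_lt h
  rw [show k + j + 1 = j + 1 + k by ring, pow_add, mul_smul, pow_self e hsucc, pow_succ, mul_smul, h0,
    smul_zero]

lemma loc_nilp (h0 : (X : ℂ[X]) • e 0 = 0)
    (hsucc : ∀ k, (X : ℂ[X]) • e (k + 1) = e k)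
    (hspan : Submodule.span ℂ[X] (Set.range e) = ⊤) (m : M) : ∃ k : ℕ, (X : ℂ[X]) ^ k • m = 0 := by
  have hm : m ∈ Submodule.span ℂ[X] (Set.range e) := hspan ▸ Submodule.mem_top
  induction hm using Submodule.span_induction with
  | mem x h => obtain ⟨k, rfl⟩ := h; exact ⟨k + 1, pow_lt e h0 hsucc (Nat.lt_succ_self k)⟩
  | zero => exact ⟨0, smul_zero _⟩
  | add x y _ _ hx hy =>
    obtain ⟨k, hk⟩ := hx
    obtain ⟨l, hl⟩ := hy
    refine ⟨k + l, ?_⟩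
    rw [smul_add, pow_add, mul_smul _ _ y, hl, mul_comm, mul_smul, hk]; simp
  | smul p x _ hx =>
    obtain ⟨k, hk⟩ := hx
    exact ⟨k, by rw [smul_comm, hk, smul_zero]⟩

lemma x_surj (hsucc : ∀ k, (X : ℂ[X]) • e (k + 1) = e k)
    (hspan : Submodule.span ℂ[X] (Set.range e) = ⊤) (m : M) : ∃ m', (X : ℂ[X]) • m' = m := by
  have hm : m ∈ Submodule.span ℂ[X] (Set.range e) := hspan ▸ Submodule.mem_top
  induction hm using Submodule.span_induction with
  | mem x h => obtain ⟨k, rfl⟩ := h; exact ⟨_, hsucc k⟩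
  | zero => exact ⟨0, smul_zero _⟩
  | add x y _ _ hx hy =>
    obtain ⟨k, rfl⟩ := hx
    obtain ⟨l, rfl⟩ := hy
    exact ⟨k + l, smul_add _ _ _⟩
  | smul p x _ hx =>
    obtain ⟨k, rfl⟩ := hx
    exact ⟨p • k, by rw [smul_comm]⟩

lemma normal_form (f : ℕ →₀ ℂ[X]) : ∃ c : ℕ →₀ ℂ,
    f - c.mapRange C (map_zero C) ∈ LinearMap.range (dM ℂ[X]) := by
  induction f using Finsupp.induction_linear with
  | zero => exact ⟨0, by simp⟩
  | add f g hf hg =>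
    obtain ⟨c, hc⟩ := hf
    obtain ⟨c', hc'⟩ := hg
    refine ⟨c + c', ?_⟩
    rw [Finsupp.mapRange_add (map_add C)]
    convert add_mem hc hc' using 1
    abel
  | single k p =>
    induction p using Polynomial.induction_on' with
    | add p q hp hq =>
      obtain ⟨c, hc⟩ := hp
      obtain ⟨c', hc'⟩ := hq
      refine ⟨c + c', ?_⟩
      rw [Finsupp.mapRange_add (map_add C), Finsupp.single_add]
      convert add_mem hc hc' using 1
      abel
    | monomial n a =>
      induction n generalizing k with
      | zero => exact ⟨Finsupp.single k a, by simp⟩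
      | succ n ih =>
        rw [← X_mul_monomial]
        cases k with
        | zero => 
          refine ⟨0, ?_⟩
          have := LinearMap.mem_range_self (dM ℂ[X]) (Finsupp.single 0 (monomial n a))
          rw [dM_single_zero] at this
          simpa using this
        | succ k =>
          obtain ⟨c, hc⟩ := ih k
          refine ⟨c, ?_⟩
          have := LinearMap.mem_range_self (dM ℂ[X]) (Finsupp.single (k + 1) (monomial n a))
          rw [dM_single_succ] at this
          convert add_mem this hc using 1
          rw [smul_eq_mul]
          abel

/-- augmentation -/
noncomputable def epsM : (ℕ →₀ ℂ[X]) →ₗ[ℂ[X]] M := Finsupp.linearCombination ℂ[X] e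

lemma eps_d (h0 : (X : ℂ[X]) • e 0 = 0)
    (hsucc : ∀ k, (X : ℂ[X]) • e (k + 1) = e k) (f : ℕ →₀ ℂ[X]) : epsM e (dM ℂ[X] f) = 0 := by
  induction f using Finsupp.induction_linear with
  | zero => simp
  | add f g hf hg => rw [map_add, map_add, hf, hg, add_zero]
  | single k p =>
    cases k with
    | zero => rw [dM_single_zero, epsM, Finsupp.linearCombination_single, smul_eq_mul, mul_comm, mul_smul, h0,
        smul_zero]
    | succ k => rw [dM_single_succ, epsM, map_sub, Finsupp.linearCombination_single,
        Finsupp.linearCombination_single, smul_eq_mul, mul_comm, mul_smul, hsucc, sub_self]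

lemma const_inj (h0 : (X : ℂ[X]) • e 0 = 0)
    (hsucc : ∀ k, (X : ℂ[X]) • e (k + 1) = e k)
    (hne : e 0 ≠ 0) (c : ℕ →₀ ℂ) (h : epsM e (c.mapRange C (map_zero C)) = 0) : c = 0 := by
  by_contra hc
  have hs : c.support.Nonempty := Finsupp.support_nonempty_iff.2 hc
  set K := c.support.max' hs with hK
  have hKm : K ∈ c.support := Finset.max'_mem _ _
  have h1 : (X : ℂ[X]) ^ K • epsM e (c.mapRange C (map_zero C)) = C (c K) • e 0 := by
    rw [epsM, Finsupp.linearCombination_apply, Finsupp.sum_mapRange_index (by simp), Finsupp.sum,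
      Finset.smul_sum, Finset.sum_eq_single K]
    · rw [smul_comm, pow_self e hsucc]
    · intro b hb hbK
      have : b < K := lt_of_le_of_ne (Finset.le_max' _ _ hb) hbK
      rw [smul_comm, pow_lt e h0 hsucc this, smul_zero]
    · exact fun h => absurd hKm h
  rw [h, smul_zero] at h1
  apply hne
  have h2 : C (c K)⁻¹ • C (c K) • e 0 = (0 : M) := by rw [← h1, smul_zero]
  rwa [smul_smul, ← C_mul, inv_mul_cancel₀ (Finsupp.mem_support_iff.1 hKm), C_1, one_smul] at h2

lemma eps_exact (h0 : (X : ℂ[X]) • e 0 = 0)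
    (hsucc : ∀ k, (X : ℂ[X]) • e (k + 1) = e k)
    (hne : e 0 ≠ 0) : Function.Exact (dM ℂ[X]) (epsM e) := by
  intro f
  constructor
  · intro hf
    obtain ⟨c, g, hg⟩ := normal_form f
    have : epsM e (c.mapRange C (map_zero C)) = 0 := by
      have h := eps_d e h0 hsucc g
      rw [hg, map_sub, hf, zero_sub, neg_eq_zero] at h
      exact h
    have hc := const_inj e h0 hsucc hne c this
    exact ⟨g, by rw [hg, hc]; simp⟩
  · rintro ⟨g, rfl⟩
    exact eps_d e h0 hsucc g

lemma eps_surj (hspan : Submodule.span ℂ[X] (Set.range e) = ⊤) : Function.Surjective (epsM e) := by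
  rw [← LinearMap.range_eq_top, epsM, Finsupp.range_linearCombination, hspan]

theorem tor_main (h0 : (X : ℂ[X]) • e 0 = 0)
    (hsucc : ∀ k, (X : ℂ[X]) • e (k + 1) = e k)
    (hspan : Submodule.span ℂ[X] (Set.range e) = ⊤)
    (hne : e 0 ≠ 0) :
    Limits.IsZero (((Tor (ModuleCat ℂ[X]) 0).obj (ModuleCat.of _ M)).obj (ModuleCat.of _ M)) ∧
    Nonempty (((Tor (ModuleCat ℂ[X]) 1).obj (ModuleCat.of _ M)).obj (ModuleCat.of _ M) ≅
      ModuleCat.of ℂ[X] M) := by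
  let F : ModuleCat ℂ[X] := ModuleCat.of ℂ[X] (ℕ →₀ ℂ[X])
  let N : ModuleCat ℂ[X] := ModuleCat.of ℂ[X] M
  let d : F ⟶ F := ModuleCat.ofHom (dM ℂ[X])
  let ε : F ⟶ N := ModuleCat.ofHom (epsM e)
  have hF : Projective F := (IsProjective.iff_projective (R := ℂ[X]) (ℕ →₀ ℂ[X])).1 inferInstance
  have hd : Mono d := (ModuleCat.mono_iff_injective d).2 dM_inj
  have hε : Epi ε := (ModuleCat.epi_iff_surjective ε).2 (eps_surj e hspan)
  have w : d ≫ ε = 0 := ModuleCat.hom_ext (LinearMap.ext fun f => eps_d e h0 hsucc f)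
  have hex : (ShortComplex.mk d ε w).Exact :=
    (ShortComplex.ShortExact.moduleCat_exact_iff_function_exact _).2 (eps_exact e h0 hsucc hne)
  have hnil := loc_nilp e h0 hsucc hspan
  let G := (MonoidalCategory.tensoringLeft (ModuleCat ℂ[X])).obj N
  have hG : ∀ z, (G.map d).hom z = LinearMap.lTensor M (dM ℂ[X]) z := fun z => rfl
  constructor
  · refine derived_zero d ε G w hex ?_
    rw [ModuleCat.epi_iff_surjective]
    intro z
    obtain ⟨y, hy⟩ := dM_surj (x_surj e hsucc hspan) (eT M z)
    refine ⟨(eT M).symm y, (eT M).injective ?_⟩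
    refine (eT_comm _).trans ?_
    rw [LinearEquiv.apply_symm_apply, hy]
  · let i : N ⟶ G.obj F := ModuleCat.ofHom ((eT M).symm.toLinearMap ∘ₗ iM hnil)
    have hi : Mono i := (ModuleCat.mono_iff_injective i).2 
      ((eT M).symm.injective.comp (iM_inj hnil))
    have hx : Function.Exact ((eT M).symm.toLinearMap ∘ₗ iM hnil) (LinearMap.lTensor M (dM ℂ[X])) := by
      intro z
      rw [← (eT M).map_eq_zero_iff, eT_comm, iM_exact hnil]
      constructor
      · rintro ⟨y, hy⟩
        exact ⟨y, by simp [hy]⟩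
      · rintro ⟨y, rfl⟩
        exact ⟨y, by simp⟩
    have wi : i ≫ G.map d = 0 := ModuleCat.hom_ext (LinearMap.ext fun f => hx.apply_apply_eq_zero f)
    exact derived_one d ε G w hex i wi
      ((ShortComplex.ShortExact.moduleCat_exact_iff_function_exact _).2 hx)
end mods
end TorAux

namespace TorAux
open Polynomial

lemma dt0 : (derivative : Module.End ℂ ℂ[X]) * LinearMap.mulLeft ℂ X =
    LinearMap.mulLeft ℂ X * derivative + 1 := by
  refine LinearMap.ext fun f => ?_
  simp [derivative_mul, add_comm]

lemma t_inj0 (a : Module.End ℂ ℂ[X]) (h : LinearMap.mulLeft ℂ X * a = 0) : a = 0 := by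
  refine LinearMap.ext fun f => ?_
  have h1 := LinearMap.congr_fun h f
  simpa using h1

lemma t_not_surj0 (a : Module.End ℂ ℂ[X]) (h : LinearMap.mulLeft ℂ X * a = 1) : False := by
  have h1 := LinearMap.congr_fun h 1
  have h2 := congrArg (fun p => coeff p 0) h1
  simp at h2

lemma dt : dOp * tOp = tOp * dOp + 1 := dt0

lemma t_inj (a : Wc) (h : tOp * a = 0) : a = 0 := t_inj0 a h

lemma t_not_surj (a : Wc) (h : tOp * a = 1) : False := t_not_surj0 a h

/-- `ad x` -/
noncomputable def adT : Wc →ₗ[ℂ] Wc := LinearMap.mulLeft ℂ tOp - LinearMap.mulRight ℂ tOp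

lemma adT_apply (a : Wc) : adT a = tOp * a - a * tOp := rfl

lemma adT_d (a : Wc) : adT (dOp * a) = dOp * adT a - a := by
  rw [adT_apply, adT_apply, mul_sub, ← mul_assoc dOp tOp, dt]
  noncomm_ring

lemma adT_t (a : Wc) : adT (tOp * a) = tOp * adT a := by
  rw [adT_apply, adT_apply]
  noncomm_ring

lemma nil_d (k : ℕ) : ∀ a : Wc, (adT ^ k) a = 0 → (adT ^ (k + 1)) (dOp * a) = 0 := by
  induction k with
  | zero => intro a h; rw [pow_zero] at h; change a = 0 at h; rw [h, mul_zero, map_zero]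
  | succ k ih =>
    intro a h
    rw [pow_succ, Module.End.mul_apply, adT_d, map_sub, h, sub_zero]
    exact ih _ (by rwa [pow_succ, Module.End.mul_apply] at h)

lemma nil_t (k : ℕ) : ∀ a : Wc, (adT ^ k) (tOp * a) = tOp * (adT ^ k) a := by
  induction k with
  | zero => intro a; rfl
  | succ k ih =>
    intro a
    rw [pow_succ, Module.End.mul_apply, Module.End.mul_apply, adT_t, ih]

lemma nil_mono {k l : ℕ} (h : k ≤ l) (a : Wc) (ha : (adT ^ k) a = 0) : (adT ^ l) a = 0 := by
  rw [← Nat.sub_add_cancel h, pow_add, Module.End.mul_apply, ha, map_zero]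

lemma nil_mul (w : Wc) (hw : w ∈ A1s) : ∀ a : Wc, (∃ k, (adT ^ k) a = 0) → ∃ k, (adT ^ k) (w * a) = 0 := by
  refine Algebra.adjoin_induction (s := {tOp, dOp})
    (p := fun w _ => ∀ a : Wc, (∃ k, (adT ^ k) a = 0) → ∃ k, (adT ^ k) (w * a) = 0) ?_ ?_ ?_ ?_ hw
  · rintro x (rfl | rfl) a ⟨k, hk⟩
    · exact ⟨k, by rw [nil_t, hk, mul_zero]⟩
    · exact ⟨k + 1, nil_d k a hk⟩
  · rintro r a ⟨k, hk⟩
    exact ⟨k, by rw [← Algebra.smul_def, map_smul, hk, smul_zero]⟩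
  · rintro x y _ _ hx hy a ha
    obtain ⟨k, hk⟩ := hx a ha
    obtain ⟨l, hl⟩ := hy a ha
    exact ⟨max k l, by rw [add_mul, map_add, nil_mono (le_max_left _ _) _ hk,
      nil_mono (le_max_right _ _) _ hl, add_zero]⟩
  · rintro x y _ _ hx hy a ha
    rw [mul_assoc]
    exact hx _ (hy a ha)

lemma nil_all (w : Wc) (hw : w ∈ A1s) : ∃ k, (adT ^ k) w = 0 := by
  have := nil_mul w hw 1 ⟨1, by rw [pow_one, adT_apply, mul_one, one_mul, sub_self]⟩
  rwa [mul_one] at this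

lemma t_pow (c : Wc) (hc : c * tOp = 0) (k : ℕ) : (adT ^ k) c = tOp ^ k * c := by
  induction k with
  | zero => rw [pow_zero, pow_zero, one_mul]; rfl
  | succ k ih => rw [pow_succ', Module.End.mul_apply, ih, adT_apply, mul_assoc, hc, mul_zero, sub_zero,
      pow_succ', mul_assoc]

lemma t_pow_inj (k : ℕ) (c : Wc) (h : tOp ^ k * c = 0) : c = 0 := by
  induction k with
  | zero => simpa using h
  | succ k ih => rw [pow_succ', mul_assoc] at h; exact ih (t_inj _ h)

lemma no_left_inv (a : A1) (h : a * tA = 1) : False := by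
  have ha : (A1s.val a) * tOp = 1 := congrArg A1s.val h
  obtain ⟨w, hw⟩ : ∃ w : Wc, w = A1s.val a := ⟨_, rfl⟩
  have hwm : w ∈ A1s := hw ▸ Subtype.property (p := fun x => x ∈ A1s) a
  rw [← hw] at ha
  have hm : tOp * w - 1 ∈ A1s := sub_mem (mul_mem (Subtype.property (p := fun x => x ∈ A1s) tA) hwm) (one_mem _)
  obtain ⟨k, hk⟩ := nil_all _ hm
  rw [t_pow _ (by rw [sub_mul, mul_assoc, ha, mul_one, one_mul, sub_self])] at hk
  exact t_not_surj w (sub_eq_zero.1 (t_pow_inj k _ hk))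

lemma dtA : dA * tA = tA * dA + 1 := Subtype.ext dt

lemma dtA_pow (k : ℕ) : dA ^ (k + 1) * tA = tA * dA ^ (k + 1) + ((k : A1) + 1) * dA ^ k := by
  induction k with
  | zero => simp [dtA]
  | succ k ih =>
    rw [pow_succ' dA (k + 1), mul_assoc, ih, mul_add, ← mul_assoc, dtA, ← mul_assoc, ← mul_assoc,
      ((Nat.cast_commute k dA).symm.add_right (Commute.one_right dA)).eq, mul_assoc _ dA, ← pow_succ']
    push_cast
    rw [add_mul, one_mul]
    simp only [add_mul, one_mul, mul_assoc]
    abel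

/-- class of an operator -/
noncomputable def mkN : A1 →ₗ[A1] quotMod tA := (Submodule.span A1 {tA}).mkQ

lemma mkN_t (a : A1) : mkN (a * tA) = 0 :=
  (Submodule.Quotient.mk_eq_zero (Submodule.span A1 {tA})).2 (Submodule.mem_span_singleton.2 ⟨a, rfl⟩)

lemma mkN_one : mkN 1 ≠ 0 := by
  intro h
  obtain ⟨a, ha⟩ := Submodule.mem_span_singleton.1
    ((Submodule.Quotient.mk_eq_zero (Submodule.span A1 {tA})).1 h)
  exact no_left_inv a ha

lemma X_smul (n : quotMod tA) : (X : ℂ[X]) • n = tA • n := by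
  change incl X • n = tA • n
  congr 1
  exact aeval_X _

lemma C_smul (c : ℂ) (n : quotMod tA) : (C c : ℂ[X]) • n = algebraMap ℂ A1 c • n := by
  change incl (C c) • n = _
  congr 1
  exact aeval_C _ _

lemma X_mkN (k : ℕ) : (X : ℂ[X]) • mkN (dA ^ (k + 1)) = - ((C ((k : ℂ) + 1)) • mkN (dA ^ k)) := by
  have h := mkN_t (dA ^ (k + 1))
  rw [dtA_pow, map_add] at h
  rw [X_smul, C_smul, ← map_smul, ← map_smul, smul_eq_mul, smul_eq_mul, map_add, map_natCast, map_one]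
  exact eq_neg_of_add_eq_zero_left h

lemma X_mkN_zero : (X : ℂ[X]) • mkN 1 = 0 := by
  rw [X_smul, ← map_smul, smul_eq_mul, mul_one]
  simpa only [one_mul] using mkN_t 1

/-- divided power basis -/
noncomputable def eN (k : ℕ) : quotMod tA := (C ((-1) ^ k / (k.factorial : ℂ)) : ℂ[X]) • mkN (dA ^ k)

lemma eN_zero : eN 0 = mkN 1 := by simp [eN]

lemma eN_succ (k : ℕ) : (X : ℂ[X]) • eN (k + 1) = eN k := by
  rw [eN, smul_comm, X_mkN, ← neg_smul, smul_smul, ← C_neg, ← C_mul, eN]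
  congr 2
  have h1 : ((k : ℂ) + 1) ≠ 0 := by exact_mod_cast Nat.succ_ne_zero k
  have h2 : (k.factorial : ℂ) ≠ 0 := by exact_mod_cast Nat.factorial_ne_zero k
  rw [Nat.factorial_succ]
  push_cast
  field_simp
  ring

lemma mk_mem (k : ℕ) : mkN (dA ^ k) ∈ Submodule.span ℂ[X] (Set.range eN) := by
  have h2 : (k.factorial : ℂ) ≠ 0 := by exact_mod_cast Nat.factorial_ne_zero k
  have : mkN (dA ^ k) = (C ((k.factorial : ℂ) * (-1) ^ k) : ℂ[X]) • eN k := by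
    rw [eN, smul_smul, ← C_mul]
    have : (k.factorial : ℂ) * (-1) ^ k * ((-1) ^ k / (k.factorial : ℂ)) = 1 := by
      field_simp
      rw [← pow_mul, mul_comm k, pow_mul]
      simp
    rw [this, C_1, one_smul]
  rw [this]
  exact Submodule.smul_mem _ _ (Submodule.subset_span ⟨k, rfl⟩)

lemma d_incl (p : ℂ[X]) : dA * incl p = incl p * dA + incl (derivative p) := by
  have hX : incl X = tA := aeval_X _
  have hC : ∀ c, incl (C c) = algebraMap ℂ A1 c := fun c => aeval_C _ _
  induction p using Polynomial.induction_on with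
  | C a => rw [derivative_C, map_zero, add_zero, hC, Algebra.commutes]
  | add p q hp hq => simp only [map_add, mul_add, add_mul, hp, hq]; abel
  | monomial n a h =>
    rw [pow_succ, ← mul_assoc, derivative_mul, derivative_X, mul_one, map_add,
      map_mul incl (C a * X ^ n) X, map_mul incl (derivative (C a * X ^ n)) X, hX,
      ← mul_assoc, h, add_mul, mul_assoc, dtA]
    noncomm_ring

lemma stable (w : A1) : ∀ n ∈ Submodule.span ℂ[X] (Set.range (fun k => mkN (dA ^ k))),
    w • n ∈ Submodule.span ℂ[X] (Set.range (fun k => mkN (dA ^ k))) := by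
  obtain ⟨w, hw⟩ := w
  refine Algebra.adjoin_induction (s := {tOp, dOp})
    (p := fun w hw => ∀ n ∈ Submodule.span ℂ[X] (Set.range (fun k => mkN (dA ^ k))),
    (show A1 from (⟨w, hw⟩ : A1s)) • n ∈ Submodule.span ℂ[X] (Set.range (fun k => mkN (dA ^ k)))) ?_ ?_ ?_ ?_ hw
  · rintro x (rfl | rfl) n hn
    · change tA • n ∈ _
      rw [← X_smul]
      exact Submodule.smul_mem _ _ hn
    · change dA • n ∈ _
      induction hn using Submodule.span_induction with
      | mem x h =>
        obtain ⟨k, rfl⟩ := h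
        refine Submodule.subset_span ⟨k + 1, ?_⟩
        simp only
        rw [← map_smul, smul_eq_mul, pow_succ']
      | zero => rw [smul_zero]; exact zero_mem _
      | add x y _ _ hx hy => rw [smul_add]; exact add_mem hx hy
      | smul p x hx0 hx =>
        have : dA • p • x = p • dA • x + derivative p • x := by
          change dA • incl p • x = incl p • dA • x + incl (derivative p) • x
          rw [smul_smul, d_incl, add_smul, mul_smul]
        rw [this]
        exact add_mem (Submodule.smul_mem _ _ hx) (Submodule.smul_mem _ _ hx0)
  · intro r n hn
    have h := Submodule.smul_mem _ (C r) hn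
    rw [C_smul] at h
    exact h
  · intro x y hx' hy' hx hy n hn
    have h := add_mem (hx n hn) (hy n hn)
    rw [← add_smul] at h
    exact h
  · intro x y hx' hy' hx hy n hn
    have h := hx _ (hy n hn)
    rw [smul_smul] at h
    exact h

lemma eN_span : Submodule.span ℂ[X] (Set.range eN) = ⊤ := by
  rw [eq_top_iff]
  rintro n -
  obtain ⟨a, rfl⟩ := Submodule.mkQ_surjective (Submodule.span A1 {tA}) n
  have h1 : Submodule.span ℂ[X] (Set.range (fun k => mkN (dA ^ k))) ≤ Submodule.span ℂ[X] (Set.range eN) := by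
    rw [Submodule.span_le]
    rintro _ ⟨k, rfl⟩
    exact mk_mem k
  refine h1 ?_
  have h2 := stable a (mkN (dA ^ 0)) (Submodule.subset_span ⟨0, rfl⟩)
  rw [← map_smul, smul_eq_mul, pow_zero, mul_one] at h2
  exact h2

end TorAux

/-- for `N = A_1/A_1·x`, one has `Tor_0^{ℂ[x]}(N,N) = 0` and
`Tor_1^{ℂ[x]}(N,N) ≅ A_1/A_1·x` as `ℂ[x]`-modules. -/
theorem stmt_15 :
    CategoryTheory.Limits.IsZero (TorObj 0 tA tA) ∧
    Nonempty (TorObj 1 tA tA ≅ ModuleCat.of (Polynomial ℂ) (quotMod tA)) := by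
  have h0 : (Polynomial.X : Polynomial ℂ) • TorAux.eN 0 = 0 := by
    rw [TorAux.eN_zero]; exact TorAux.X_mkN_zero
  have hne : TorAux.eN 0 ≠ 0 := by
    rw [TorAux.eN_zero]; exact TorAux.mkN_one
  exact TorAux.tor_main TorAux.eN h0 TorAux.eN_succ TorAux.eN_span hne
end

section
/- Let A_1 = ℂ⟨x,∂⟩, M = A_1/A_1·(x∂ + 1) and N = A_1/A_1·x, regarded as ℂ[x]-modules. Then Tor_i^{ℂ[x]}(M,N) = 0 for i = 0 and i = 1. -/
open CategoryTheory

noncomputable section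

set_option maxHeartbeats 1000000
set_option synthInstance.maxHeartbeats 1000000

section aux
open Polynomial

/-- Evaluation of elements of `A_1` as operators on polynomials. -/
def ev : A1 →ₐ[ℂ] Module.End ℂ (Polynomial ℂ) := A1s.val

lemma ev_inj {P Q : A1} (h : ∀ g, ev P g = ev Q g) : P = Q :=
  Subtype.ext (LinearMap.ext h)

lemma ev_tA (g : Polynomial ℂ) : ev tA g = X * g := rfl
lemma ev_dA (g : Polynomial ℂ) : ev dA g = derivative g := rfl
lemma ev_mul (P Q : A1) (g : Polynomial ℂ) : ev (P * Q) g = ev P (ev Q g) := by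
  rw [map_mul]; rfl

lemma ev_incl (f g : Polynomial ℂ) : ev (incl f) g = f * g := by
  induction f using Polynomial.induction_on' generalizing g with
  | add p q hp hq => rw [map_add, map_add, LinearMap.add_apply, hp, hq, add_mul]
  | monomial n a =>
    have : incl (monomial n a) = a • tA ^ n := by
      change aeval tA (monomial n a) = _
      rw [aeval_monomial, Algebra.smul_def]
    rw [this, map_smul, map_pow, LinearMap.smul_apply]
    have h2 : ∀ n : ℕ, ((ev tA) ^ n) g = X ^ n * g := by
      intro n
      induction n with
      | zero => simp
      | succ n ih => rw [pow_succ', Module.End.mul_apply, ih, ev_tA, pow_succ']; ring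
    rw [h2, ← C_mul_X_pow_eq_monomial, mul_assoc, smul_eq_C_mul]

lemma A1_induction {p : A1 → Prop} (h1 : p 1) (hadd : ∀ a b, p a → p b → p (a + b))
    (hsmul : ∀ (c : ℂ) a, p a → p (c • a)) (ht : ∀ a, p a → p (tA * a))
    (hd : ∀ a, p a → p (dA * a)) (a : A1) : p a := by
  suffices H : ∀ (w : Wc) (hw : w ∈ A1s), ∀ b : A1, p b → p ((show A1 from ⟨w, hw⟩) * b) by
    have := H a.1 a.2 1 h1
    rwa [mul_one] at this
  intro w hw
  refine Algebra.adjoin_induction (p := fun w hw => ∀ b : A1, p b → p ((show A1 from ⟨w, hw⟩) * b))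
    ?_ ?_ ?_ ?_ hw
  · rintro x (rfl | rfl) b hb
    · exact ht b hb
    · exact hd b hb
  · intro r b hb
    have := hsmul r b hb
    rwa [Algebra.smul_def] at this
  · intro x y hx hy h1 h2 b hb
    have := hadd _ _ (h1 b hb) (h2 b hb)
    rwa [← add_mul] at this
  · intro x y hx hy h1 h2 b hb
    have := h1 _ (h2 b hb)
    rwa [← mul_assoc] at this

lemma dA_incl (f : Polynomial ℂ) : dA * incl f = incl f * dA + incl (derivative f) := by
  apply ev_inj
  intro g
  rw [map_add, LinearMap.add_apply]
  simp only [ev_mul, ev_dA, ev_incl, derivative_mul]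
  ring

lemma rel_eq : tA * dA + 1 = dA * tA := by
  have := dA_incl X
  rw [incl_X, derivative_X, map_one] at this
  exact this.symm

lemma incl_dA (f : Polynomial ℂ) : incl f * dA = dA * incl f - incl (derivative f) := by
  rw [dA_incl]; abel

lemma incl_comm_t (f : Polynomial ℂ) : incl f * tA = tA * incl f := by
  rw [← incl_X, ← map_mul, ← map_mul, mul_comm]

lemma incl_smul (c : ℂ) (f : Polynomial ℂ) : incl (c • f) = c • incl f :=
  map_smul (aeval tA) c f

/-- Coefficients of operators in `A_1` are polynomial. -/
lemma coeff_poly (Q : A1) : ∀ a b : ℕ, ∃ q : Polynomial ℂ, ∃ n0 : ℕ, ∀ n : ℕ, n0 ≤ n →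
    (ev Q (X ^ (n + a))).coeff (n + b) = q.eval (n : ℂ) := by
  induction Q using A1_induction with
  | h1 =>
    intro a b
    refine ⟨C (if b = a then 1 else 0), 0, fun n _ => ?_⟩
    rw [map_one, Module.End.one_apply, coeff_X_pow, eval_C]
    simp
  | hadd P Q hP hQ =>
    intro a b
    obtain ⟨p, n0, hp⟩ := hP a b
    obtain ⟨q, n1, hq⟩ := hQ a b
    refine ⟨p + q, max n0 n1, fun n hn => ?_⟩
    rw [map_add, LinearMap.add_apply, coeff_add, hp n (by omega), hq n (by omega), eval_add]
  | hsmul c P hP =>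
    intro a b
    obtain ⟨p, n0, hp⟩ := hP a b
    refine ⟨c • p, n0, fun n hn => ?_⟩
    rw [map_smul, LinearMap.smul_apply, coeff_smul, hp n hn, eval_smul]
  | ht P hP =>
    intro a b
    cases b with
    | succ b =>
      obtain ⟨p, n0, hp⟩ := hP a b
      refine ⟨p, n0, fun n hn => ?_⟩
      rw [ev_mul, ev_tA, ← add_assoc, coeff_X_mul, hp n hn]
    | zero =>
      obtain ⟨p, n0, hp⟩ := hP (a + 1) 0
      refine ⟨p.comp (X - 1), n0 + 1, fun n hn => ?_⟩
      obtain ⟨m, rfl⟩ : ∃ m, n = m + 1 := ⟨n - 1, by omega⟩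
      have := hp m (by omega)
      rw [ev_mul, ev_tA, add_zero, coeff_X_mul]
      rw [show m + 1 + a = m + (a + 1) by ring, ← add_zero m, add_zero m]
      simpa using this
  | hd P hP =>
    intro a b
    obtain ⟨p, n0, hp⟩ := hP a (b + 1)
    refine ⟨p * (X + C ((b : ℂ) + 1)), n0, fun n hn => ?_⟩
    rw [ev_mul, ev_dA, coeff_derivative, add_assoc, hp n hn]
    simp [add_assoc]

lemma mem_iff (a b : A1) : b ∈ Submodule.span A1 {a} ↔ ∃ Q, Q * a = b := by
  rw [Submodule.mem_span_singleton]; rfl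

lemma incl_inj_M (f : Polynomial ℂ) (Q : A1) (h : Q * (dA * tA) = incl f) : f = 0 := by
  ext j
  obtain ⟨q, n0, hq⟩ := coeff_poly Q 0 j
  have key : ∀ n : ℕ, n0 ≤ n → ((X + 1) * q - C (f.coeff j)).eval (n : ℂ) = 0 := by
    intro n hn
    have h1 := congrArg (fun P => (ev P (X ^ n)).coeff (n + j)) h
    simp only [ev_mul, ev_incl, ev_dA, ev_tA] at h1
    rw [add_comm n j, coeff_mul_X_pow, ← pow_succ', derivative_X_pow, ← smul_eq_C_mul, map_smul,
      coeff_smul, Nat.add_sub_cancel, add_comm j n] at h1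
    have := hq n hn
    rw [add_zero] at this
    rw [this] at h1
    rw [eval_sub, eval_C, ← h1]
    simp
  have hz : (X + 1) * q - C (f.coeff j) = 0 := by
    apply eq_zero_of_infinite_isRoot
    refine Set.Infinite.mono (s := (fun n : ℕ => ((n + n0 : ℕ) : ℂ)) '' Set.univ) ?_ ?_
    · rintro _ ⟨n, -, rfl⟩
      exact key _ (by omega)
    · refine Set.infinite_univ.image ?_
      intro a _ b _ hab
      have : a + n0 = b + n0 := by
        simp only [Nat.cast_inj] at hab
        exact hab
      omega
  have := congrArg (eval (-1)) hz
  simpa using this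


lemma pow_commute (n : ℕ) : dA * tA ^ n = tA ^ n * dA + (n : ℂ) • tA ^ (n - 1) := by
  have := dA_incl (X ^ n)
  rw [derivative_X_pow, ← smul_eq_C_mul, incl_smul, map_pow, map_pow, incl_X] at this
  exact this

/-- `A_1` is spanned by `x^a ∂^b`. -/
lemma normal_form (P : A1) :
    P ∈ Submodule.span ℂ (Set.range fun ab : ℕ × ℕ => tA ^ ab.1 * dA ^ ab.2) := by
  induction P using A1_induction with
  | h1 => exact Submodule.subset_span ⟨(0, 0), by simp⟩
  | hadd P Q hP hQ => exact add_mem hP hQ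
  | hsmul c P hP => exact Submodule.smul_mem _ _ hP
  | ht P hP =>
    induction hP using Submodule.span_induction with
    | mem x h =>
      obtain ⟨⟨a, b⟩, rfl⟩ := h
      exact Submodule.subset_span ⟨(a + 1, b), by simp only [pow_succ', mul_assoc]⟩
    | zero => rw [mul_zero]; exact zero_mem _
    | add x y _ _ hx hy => rw [mul_add]; exact add_mem hx hy
    | smul c x _ hx => rw [mul_smul_comm]; exact Submodule.smul_mem _ _ hx
  | hd P hP =>
    induction hP using Submodule.span_induction with
    | mem x h =>
      obtain ⟨⟨a, b⟩, rfl⟩ := h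
      have : dA * (tA ^ a * dA ^ b) = tA ^ a * dA ^ (b + 1) + (a : ℂ) • (tA ^ (a - 1) * dA ^ b) := by
        rw [← mul_assoc, pow_commute, add_mul, pow_succ', mul_assoc, smul_mul_assoc]
      simp only [this]
      exact add_mem (Submodule.subset_span ⟨(a, b + 1), rfl⟩)
        (Submodule.smul_mem _ _ (Submodule.subset_span ⟨(a - 1, b), rfl⟩))
    | zero => rw [mul_zero]; exact zero_mem _
    | add x y _ _ hx hy => rw [mul_add]; exact add_mem hx hy
    | smul c x _ hx => rw [mul_smul_comm]; exact Submodule.smul_mem _ _ hx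

/-- `A_1 = xA_1 + ℂ[∂]`. -/
lemma decomp (P : A1) : ∃ (Q : A1) (b : Polynomial ℂ), P = tA * Q + aeval dA b := by
  induction normal_form P using Submodule.span_induction with
  | mem x h =>
    obtain ⟨⟨a, b⟩, rfl⟩ := h
    cases a with
    | zero => exact ⟨0, X ^ b, by simp⟩
    | succ a => exact ⟨tA ^ a * dA ^ b, 0, by simp [pow_succ', mul_assoc]⟩
  | zero => exact ⟨0, 0, by simp⟩
  | add P Q _ _ hP hQ =>
    obtain ⟨p, b, rfl⟩ := hP
    obtain ⟨q, c, rfl⟩ := hQ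
    exact ⟨p + q, b + c, by rw [map_add, mul_add]; abel⟩
  | smul c P _ hP =>
    obtain ⟨p, b, rfl⟩ := hP
    exact ⟨c • p, c • b, by rw [map_smul, smul_add, mul_smul_comm]⟩

lemma coeff_zero_d (b : Polynomial ℂ) (k : ℕ) :
    (ev (aeval dA b) (X ^ k)).coeff 0 = (k.factorial : ℂ) * b.coeff k := by
  induction b using Polynomial.induction_on' with
  | add p q hp hq => rw [map_add, map_add, LinearMap.add_apply, coeff_add, hp, hq, coeff_add, mul_add]
  | monomial n a =>
    have h2 : ∀ (n : ℕ) (g : Polynomial ℂ), ((ev dA) ^ n) g = derivative^[n] g := by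
      intro n g
      rw [Module.End.pow_apply]
      rfl
    rw [aeval_monomial, ← Algebra.smul_def, map_smul, LinearMap.smul_apply, map_pow ev, h2,
      coeff_smul, coeff_iterate_derivative, coeff_X_pow, coeff_monomial, zero_add]
    by_cases h : n = k
    · subst h
      simp [Nat.descFactorial_self, mul_comm]
    · simp [h]

lemma dvd_of_const (P : A1) (h : ∀ g, (ev P g).coeff 0 = 0) : ∃ Q, P = tA * Q := by
  obtain ⟨Q, b, rfl⟩ := decomp P
  have hb : b = 0 := by
    ext k
    have := h (X ^ k)
    rw [map_add, LinearMap.add_apply, coeff_add, ev_mul, ev_tA, coeff_X_mul_zero, zero_add,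
      coeff_zero_d] at this
    simpa [Nat.factorial_ne_zero] using this
  exact ⟨Q, by simp [hb]⟩

lemma dt_surj (g : Polynomial ℂ) : ∃ h : Polynomial ℂ, ev (dA * tA) h = g := by
  induction g using Polynomial.induction_on' with
  | add p q hp hq =>
    obtain ⟨a, rfl⟩ := hp
    obtain ⟨b, rfl⟩ := hq
    exact ⟨a + b, map_add _ _ _⟩
  | monomial n a =>
    refine ⟨monomial n (a / (n + 1)), ?_⟩
    rw [ev_mul, ev_dA, ev_tA, X_mul_monomial, derivative_monomial]
    have : (n : ℂ) + 1 ≠ 0 := by exact_mod_cast n.succ_ne_zero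
    simp [this]

lemma x_inj (P Q : A1) (h : Q * (dA * tA) = tA * P) : ∃ Q', Q' * (dA * tA) = P := by
  obtain ⟨Q', rfl⟩ : ∃ Q', Q = tA * Q' := by
    apply dvd_of_const
    intro g
    obtain ⟨g, rfl⟩ := dt_surj g
    rw [← ev_mul, h, ev_mul, ev_tA, coeff_X_mul_zero]
  refine ⟨Q', ev_inj fun g => ?_⟩
  have := congrArg (fun P => ev P g) h
  simp only [mul_assoc] at this
  rw [ev_mul, ev_mul tA P, ev_tA, ev_tA] at this
  exact mul_left_cancel₀ X_ne_zero this

lemma dpow_t (k : ℕ) : dA ^ (k + 1) * tA = tA * dA ^ (k + 1) + ((k : ℂ) + 1) • dA ^ k := by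
  induction k with
  | zero =>
    have := rel_eq
    simp [← rel_eq]
  | succ k ih =>
    rw [pow_succ', mul_assoc, ih, mul_add, ← mul_assoc, ← rel_eq, add_mul, one_mul, mul_smul_comm,
      ← pow_succ', mul_assoc, ← pow_succ', add_assoc, ← one_smul ℂ (dA ^ (k + 1))]
    push_cast
    simp only [one_smul, add_smul]
    abel

lemma x_surj (P : A1) : ∃ Q R : A1, P = tA * Q + R * (dA * tA) := by
  induction normal_form P using Submodule.span_induction with
  | mem x h =>
    obtain ⟨⟨a, b⟩, rfl⟩ := h
    cases a with
    | succ a => exact ⟨tA ^ a * dA ^ b, 0, by simp [pow_succ', mul_assoc]⟩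
    | zero =>
      have hb : (b : ℂ) + 1 ≠ 0 := by exact_mod_cast b.succ_ne_zero
      refine ⟨-((b : ℂ) + 1)⁻¹ • dA ^ (b + 1), ((b : ℂ) + 1)⁻¹ • dA ^ b, ?_⟩
      rw [smul_mul_assoc, ← mul_assoc, ← pow_succ, dpow_t]
      simp [smul_smul, hb]
  | zero => exact ⟨0, 0, by simp⟩
  | add P Q _ _ hP hQ =>
    obtain ⟨p, b, rfl⟩ := hP
    obtain ⟨q, c, rfl⟩ := hQ
    exact ⟨p + q, b + c, by rw [add_mul, mul_add]; abel⟩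
  | smul c P _ hP =>
    obtain ⟨p, b, rfl⟩ := hP
    exact ⟨c • p, c • b, by rw [smul_mul_assoc, smul_add, mul_smul_comm]⟩

lemma pow_commute' (k : ℕ) (P : A1) :
    tA ^ (k + 1) * (dA * P) = dA * (tA * (tA ^ k * P)) - ((k : ℂ) + 1) • (tA ^ k * P) := by
  have := pow_commute (k + 1)
  rw [← mul_assoc, ← mul_assoc, ← mul_assoc, mul_assoc dA, ← pow_succ', this]
  simp [add_mul]

/-- Every element of `M` becomes polynomial after multiplying by a power of `x`. -/
lemma M_loc (P : A1) : ∃ (k : ℕ) (f : Polynomial ℂ) (R : A1),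
    tA ^ k * P = incl f + R * (dA * tA) := by
  induction P using A1_induction with
  | h1 => exact ⟨0, 1, 0, by simp⟩
  | hadd P Q hP hQ =>
    obtain ⟨k, f, R, h⟩ := hP
    obtain ⟨l, g, S, h'⟩ := hQ
    refine ⟨k + l, X ^ l * f + X ^ k * g, tA ^ l * R + tA ^ k * S, ?_⟩
    rw [mul_add, pow_add, mul_assoc _ _ Q, h', ← pow_add, add_comm k l, pow_add, mul_assoc, h]
    simp only [map_add, map_mul, map_pow, incl_X, mul_add, add_mul, mul_assoc]
    abel
  | hsmul c P hP =>
    obtain ⟨k, f, R, h⟩ := hP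
    exact ⟨k, c • f, c • R, by rw [mul_smul_comm, h, smul_add, incl_smul, smul_mul_assoc]⟩
  | ht P hP =>
    obtain ⟨k, f, R, h⟩ := hP
    refine ⟨k, X * f, tA * R, ?_⟩
    rw [← mul_assoc, ← pow_succ, pow_succ', mul_assoc, h, map_mul, incl_X, mul_add, mul_assoc]
  | hd P hP =>
    obtain ⟨k, f, R, h⟩ := hP
    refine ⟨k + 1, X * derivative f - ((k : ℂ) + 1) • f,
      incl f + dA * tA * R - ((k : ℂ) + 1) • R, ?_⟩
    rw [pow_commute', h]
    have h1 : dA * (tA * incl f) = incl f * (dA * tA) + incl (X * derivative f) := by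
      rw [← incl_comm_t, ← mul_assoc, dA_incl, add_mul, mul_assoc, incl_comm_t (derivative f), map_mul, incl_X]
    simp only [mul_add, add_mul, sub_mul, map_sub, smul_add, incl_smul, smul_mul_assoc, h1, mul_assoc]
    abel

lemma N_tors (P : A1) : ∃ (k : ℕ) (R : A1), tA ^ k * P = R * tA := by
  induction P using A1_induction with
  | h1 => exact ⟨1, 1, by simp⟩
  | hadd P Q hP hQ =>
    obtain ⟨k, R, h⟩ := hP
    obtain ⟨l, S, h'⟩ := hQ
    refine ⟨k + l, tA ^ l * R + tA ^ k * S, ?_⟩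
    rw [mul_add, pow_add, mul_assoc _ _ Q, h', ← pow_add, add_comm k l, pow_add, mul_assoc, h]
    simp only [add_mul, mul_assoc]
  | hsmul c P hP =>
    obtain ⟨k, R, h⟩ := hP
    exact ⟨k, c • R, by rw [mul_smul_comm, h, smul_mul_assoc]⟩
  | ht P hP =>
    obtain ⟨k, R, h⟩ := hP
    refine ⟨k, tA * R, ?_⟩
    rw [← mul_assoc, ← pow_succ, pow_succ', mul_assoc, h, mul_assoc]
  | hd P hP =>
    obtain ⟨k, R, h⟩ := hP
    refine ⟨k + 1, dA * tA * R - ((k : ℂ) + 1) • R, ?_⟩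
    rw [pow_commute', h]
    simp only [sub_mul, smul_mul_assoc, mul_assoc]

/-- The class of an operator. -/
def cls (a P : A1) : quotMod a := (Submodule.span A1 {a}).mkQ P

lemma cls_surj (a : A1) (m : quotMod a) : ∃ P, cls a P = m := Submodule.mkQ_surjective _ m

lemma smul_cls (a P : A1) (f : Polynomial ℂ) : f • cls a P = cls a (incl f * P) := rfl

lemma cls_eq_zero (a P : A1) : cls a P = 0 ↔ ∃ Q, Q * a = P := by
  rw [← mem_iff]
  exact Submodule.Quotient.mk_eq_zero _

lemma cls_add (a P Q : A1) : cls a (P + Q) = cls a P + cls a Q := rfl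

lemma M_X_inj (m : quotMod (dA * tA)) (h : (X : Polynomial ℂ) • m = 0) : m = 0 := by
  obtain ⟨P, rfl⟩ := cls_surj _ m
  rw [smul_cls, cls_eq_zero, incl_X] at h
  obtain ⟨Q, hQ⟩ := h
  exact (cls_eq_zero _ _).2 (x_inj P Q hQ)

lemma M_Xpow_inj (k : ℕ) (m : quotMod (dA * tA)) (h : (X ^ k : Polynomial ℂ) • m = 0) : m = 0 := by
  induction k with
  | zero => simpa using h
  | succ k ih =>
    rw [pow_succ', mul_smul] at h
    exact ih (M_X_inj _ h)

lemma M_Xpow_surj (k : ℕ) (m : quotMod (dA * tA)) : ∃ m', (X ^ k : Polynomial ℂ) • m' = m := by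
  induction k generalizing m with
  | zero => exact ⟨m, by simp⟩
  | succ k ih =>
    obtain ⟨P, rfl⟩ := cls_surj _ m
    obtain ⟨Q, R, rfl⟩ := x_surj P
    obtain ⟨m', hm'⟩ := ih (cls _ Q)
    refine ⟨m', ?_⟩
    rw [pow_succ', mul_smul, hm', smul_cls, incl_X, cls_add, (cls_eq_zero _ (R * _)).2 ⟨R, rfl⟩,
      add_zero]

lemma M_torsionFree (p : Polynomial ℂ) (hp : p ≠ 0) (m : quotMod (dA * tA)) (h : p • m = 0) :
    m = 0 := by
  obtain ⟨P, rfl⟩ := cls_surj _ m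
  obtain ⟨k, f, R, hk⟩ := M_loc P
  have h1 : (X ^ k : Polynomial ℂ) • cls (dA * tA) P = cls _ (incl f) := by
    rw [smul_cls, map_pow, incl_X, hk, cls_add, (cls_eq_zero _ (R * _)).2 ⟨R, rfl⟩, add_zero]
  have h2 : p • cls (dA * tA) (incl f) = 0 := by
    rw [← h1, smul_comm, h, smul_zero]
  rw [smul_cls, cls_eq_zero, ← map_mul] at h2
  obtain ⟨Q, hQ⟩ := h2
  have hf : f = 0 := (mul_eq_zero.1 (incl_inj_M _ Q hQ)).resolve_left hp
  apply M_Xpow_inj k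
  rw [h1, hf, map_zero]
  exact (cls_eq_zero _ _).2 ⟨0, by simp⟩

lemma M_flat : Module.Flat (Polynomial ℂ) (quotMod (dA * tA)) := by
  rw [Module.Flat.flat_iff_torsion_eq_bot_of_isBezout, eq_bot_iff]
  rintro m ⟨p, hp⟩
  exact M_torsionFree p (nonZeroDivisors.ne_zero p.2) m hp

lemma tensor_zero : Subsingleton (TensorProduct (Polynomial ℂ) (quotMod (dA * tA)) (quotMod tA)) := by
  refine subsingleton_of_forall_eq 0 fun z => ?_
  induction z using TensorProduct.induction_on with
  | zero => rfl
  | add x y hx hy => rw [hx, hy, add_zero]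
  | tmul m n =>
    obtain ⟨P, rfl⟩ := cls_surj _ n
    obtain ⟨k, R, hk⟩ := N_tors P
    obtain ⟨m', rfl⟩ := M_Xpow_surj k m
    rw [TensorProduct.smul_tmul, smul_cls, map_pow, incl_X, hk, (cls_eq_zero _ _).2 ⟨R, rfl⟩,
      TensorProduct.tmul_zero]

lemma isZero_Tor_succ_of_flat {R : Type} [CommRing R] (M N : ModuleCat.{0} R) [Module.Flat R M]
    (n : ℕ) : Limits.IsZero (((Tor (ModuleCat R) (n + 1)).obj M).obj N) := by
  let P := projectiveResolution N
  refine Limits.IsZero.of_iso ?_ (P.isoLeftDerivedObj ((MonoidalCategory.tensoringLeft _).obj M) (n + 1))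
  refine (HomologicalComplex.exactAt_iff_isZero_homology _ _).1 ?_
  rw [HomologicalComplex.exactAt_iff' _ (n + 2) (n + 1) n (by simp) (by simp)]
  exact Module.Flat.lTensor_shortComplex_exact M _ (P.exact_succ n)

end aux

end


/-- for `M = A_1/A_1·(x∂+1)` and `N = A_1/A_1·x`,
`Tor_i^{ℂ[x]}(M,N) = 0` for `i = 0` and `i = 1`. -/
theorem stmt_16 :
    CategoryTheory.Limits.IsZero (TorObj 0 (tA * dA + 1) tA) ∧
    CategoryTheory.Limits.IsZero (TorObj 1 (tA * dA + 1) tA) := by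
  rw [rel_eq]
  constructor
  · refine Limits.IsZero.of_iso ?_
      ((((MonoidalCategory.tensoringLeft (ModuleCat (Polynomial ℂ))).obj
        (ModuleCat.of _ (quotMod (dA * tA)))).leftDerivedZeroIsoSelf).app
          (ModuleCat.of _ (quotMod tA)))
    have := tensor_zero
    exact ModuleCat.isZero_of_iff_subsingleton.2 tensor_zero
  · have := M_flat
    exact isZero_Tor_succ_of_flat (ModuleCat.of _ (quotMod (dA * tA)))
      (ModuleCat.of _ (quotMod tA)) 0
end
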